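/- arXiv:2010.12336 — 7 statements merged into one kernel-verified Lean document; each statement's English description precedes it below -/
import Mathlib

section
/- Let p₁,…,pₙ be pairwise distinct points of ℂ and let X = ℂ ∖ {p₁,…,pₙ} with the subspace topology. The continuous map ι : X → C_{n+1}(ℂ) defined by ι(z) = (p₁,…,pₙ,z) (whose image is the fiber over (p₁,…,pₙ) of the projection C_{n+1}(ℂ) → C_n(ℂ) onto the first n coordinates) induces an injective homomorphism on fundamental groups π₁(X, q) → π₁(C_{n+1}(ℂ), ι(q)) for every basepoint q ∈ X. -/
open unitInterval
lemma theta_inj {n : ℕ} (d : ℝ) (hd : 0 < d) (u v : Fin n → ℂ)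
    (hsep : ∀ i j, i ≠ j → d ≤ ‖u i - u j‖) (huv : ∀ i, ‖v i - u i‖ ≤ d / (n+1)) (z : ℂ)
    (hz : ∀ i, z ≠ u i) (i : Fin n) :
    z + ∑ j, ((max 0 (1 - ‖z - u j‖ / d) : ℝ) : ℂ) * (v j - u j) ≠ v i := by
  intro h
  have h1 : u i + ∑ j, ((max 0 (1 - ‖u i - u j‖ / d) : ℝ) : ℂ) * (v j - u j) = v i := by
    rw [Finset.sum_eq_single i]
    · simp
    · intro j _ hj
      have : 1 - ‖u i - u j‖ / d ≤ 0 := by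
        have := (one_le_div hd).2 (hsep i j hj.symm)
        linarith
      rw [max_eq_left this]; simp
    · simp
  have h2 : z - u i = ∑ j, (((max 0 (1 - ‖u i - u j‖ / d) : ℝ) : ℂ)
      - ((max 0 (1 - ‖z - u j‖ / d) : ℝ) : ℂ)) * (v j - u j) := by
    simp only [sub_mul, Finset.sum_sub_distrib] at *
    linear_combination h - h1
  have hpos : 0 < ‖z - u i‖ := norm_pos_iff.2 (sub_ne_zero.2 (hz i))
  have h3 : ‖z - u i‖ ≤ ∑ j : Fin n, ‖z - u i‖ / d * (d / (n+1)) := by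
    conv_lhs => rw [h2]
    refine (norm_sum_le _ _).trans (Finset.sum_le_sum fun j _ => ?_)
    rw [norm_mul]
    refine mul_le_mul ?_ (huv j) (norm_nonneg _) (by positivity)
    rw [← Complex.ofReal_sub, Complex.norm_real, Real.norm_eq_abs]
    rw [max_comm 0, max_comm 0]
    refine (abs_max_sub_max_le_abs _ _ _).trans ?_
    have : 1 - ‖u i - u j‖ / d - (1 - ‖z - u j‖ / d) = (‖z - u j‖ - ‖u i - u j‖) / d := by ring
    rw [this, abs_div, abs_of_pos hd]
    gcongr
    refine (abs_norm_sub_norm_le _ _).trans (le_of_eq ?_)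
    congr 1; ring
  rw [Finset.sum_const, Finset.card_univ, Fintype.card_fin, nsmul_eq_mul] at h3
  have h4 : (n:ℝ) * (‖z - u i‖ / d * (d / (n+1))) = ‖z - u i‖ * (n / (n+1)) := by
    field_simp
  rw [h4] at h3
  have h5 : (n:ℝ)/(n+1) < 1 := by rw [div_lt_one (by positivity)]; linarith
  nlinarith

/-- Elementary push. -/
noncomputable def thetaPush {n : ℕ} (d : ℝ) (u v : Fin n → ℂ) (z : ℂ) : ℂ :=
  z + ∑ j, ((max 0 (1 - ‖z - u j‖ / d) : ℝ) : ℂ) * (v j - u j)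

lemma thetaPush_self {n : ℕ} (d : ℝ) (u : Fin n → ℂ) (z : ℂ) : thetaPush d u u z = z := by
  simp [thetaPush]

lemma thetaPush_far {n : ℕ} (d : ℝ) (hd : 0 < d) (u v : Fin n → ℂ) (z : ℂ)
    (h : ∀ j, d ≤ ‖z - u j‖) : thetaPush d u v z = z := by
  unfold thetaPush
  rw [Finset.sum_eq_zero, add_zero]
  intro j _
  have : 1 - ‖z - u j‖ / d ≤ 0 := by
    have := (one_le_div hd).2 (h j)
    linarith
  rw [max_eq_left this]; simp

lemma thetaPush_continuous {n : ℕ} (d : ℝ) {Y : Type*} [TopologicalSpace Y]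
    {u v : Y → Fin n → ℂ} {z : Y → ℂ} (hu : Continuous u) (hv : Continuous v)
    (hz : Continuous z) : Continuous fun y => thetaPush d (u y) (v y) (z y) := by
  unfold thetaPush
  have h1 : ∀ j, Continuous fun y => u y j := fun j => (continuous_apply j).comp hu
  have h2 : ∀ j, Continuous fun y => v y j := fun j => (continuous_apply j).comp hv
  refine hz.add (continuous_finsetSum _ fun j _ => ?_)
  refine (Complex.continuous_ofReal.comp ?_).mul ((h2 j).sub (h1 j))
  exact continuous_const.max (continuous_const.sub ((hz.sub (h1 j)).norm.div_const d))

/-- Iterated push. -/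
noncomputable def phiPush {n : ℕ} (d h : ℝ) (k : ℝ → I → Fin n → ℂ) :
    ℕ → ℝ → I → ℂ → ℂ
  | 0, _, _, z => z
  | m+1, s, t, z => phiPush d h k m s t
      (thetaPush d (k (min s ((m+1 : ℕ) * h)) t) (k (min s (m * h)) t) z)

lemma transport {n : ℕ} (p : Fin n → ℂ) (K : I × I → Fin n → ℂ) (hK : Continuous K)
    (hinj : ∀ x i j, i ≠ j → K x i ≠ K x j) (h0 : ∀ t, K (0, t) = p)
    (hs0 : ∀ s, K (s, 0) = p) (hs1 : ∀ s, K (s, 1) = p) :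
    ∃ Φ : I → I → ℂ → ℂ, Continuous (fun y : I × I × ℂ => Φ y.1 y.2.1 y.2.2) ∧
      (∀ s t z, (∀ i, z ≠ K (s, t) i) → ∀ i, Φ s t z ≠ p i) ∧
      (∀ t z, Φ 0 t z = z) ∧ (∀ s z, Φ s 0 z = z) ∧ (∀ s z, Φ s 1 z = z) ∧
      ∃ R : ℂ, (∀ i, R ≠ p i) ∧ ∀ s t, Φ s t R = R := by
  -- separation
  have hd : ∃ d : ℝ, 0 < d ∧ ∀ x i j, i ≠ j → d ≤ ‖K x i - K x j‖ := by
    have : ∀ ij : Fin n × Fin n, ∃ d : ℝ, 0 < d ∧ (ij.1 ≠ ij.2 → ∀ x, d ≤ ‖K x ij.1 - K x ij.2‖) := by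
      rintro ⟨i, j⟩
      by_cases hij : i = j
      · exact ⟨1, one_pos, fun h => absurd hij h⟩
      have hc : Continuous fun x => ‖K x i - K x j‖ :=
        (((continuous_apply i).comp hK).sub ((continuous_apply j).comp hK)).norm
      obtain ⟨x0, -, hx0⟩ := isCompact_univ.exists_isMinOn (Set.univ_nonempty) hc.continuousOn
      exact ⟨_, norm_pos_iff.2 (sub_ne_zero.2 (hinj x0 i j hij)), fun _ x => hx0 (Set.mem_univ x)⟩
    choose D hD hD' using this
    obtain ⟨d, hd, hd'⟩ : ∃ d : ℝ, 0 < d ∧ ∀ ij, d ≤ D ij := by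
      cases isEmpty_or_nonempty (Fin n × Fin n) with
      | inl h => exact ⟨1, one_pos, fun ij => h.elim ij⟩
      | inr h =>
        obtain ⟨ij, hij⟩ := Finite.exists_min D
        exact ⟨D ij, hD ij, hij⟩
    exact ⟨d, hd, fun x i j hij => (hd' (i, j)).trans (hD' (i, j) hij x)⟩
  obtain ⟨d, hd, hsep⟩ := hd
  obtain ⟨M, hM⟩ : ∃ M : ℝ, ∀ x, ‖K x‖ ≤ M := by
    obtain ⟨x0, -, hx0⟩ := isCompact_univ.exists_isMaxOn (Set.univ_nonempty) hK.norm.continuousOn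
    exact ⟨_, fun x => hx0 (Set.mem_univ x)⟩
  have hM0 : 0 ≤ M := (norm_nonneg _).trans (hM (0, 0))
  have huc : UniformContinuous K := CompactSpace.uniformContinuous_of_continuous hK
  obtain ⟨δ, hδ, hδ'⟩ := Metric.uniformContinuous_iff.1 huc (d / (n+1)) (by positivity)
  obtain ⟨N, hN⟩ := exists_nat_gt (2 / δ)
  set h : ℝ := δ / 2 with hh
  have hh0 : 0 < h := by positivity
  have hNh : 1 ≤ N * h := by
    rw [div_lt_iff₀ hδ] at hN; rw [hh]; linarith
  set k : ℝ → I → Fin n → ℂ := fun s t => K (Set.projIcc 0 1 zero_le_one s, t) with hk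
  have hkc : Continuous fun y : ℝ × I => k y.1 y.2 :=
    hK.comp ((continuous_projIcc.comp continuous_fst).prodMk continuous_snd)
  have hkclose : ∀ s s' t i, |s - s'| ≤ h → ‖k s t i - k s' t i‖ ≤ d / (n+1) := by
    intro s s' t i hss
    have h1 : dist (k s t) (k s' t) < d / (n+1) := by
      apply hδ'
      rw [Prod.dist_eq, dist_self, max_eq_left dist_nonneg, Subtype.dist_eq, Real.dist_eq]
      refine (Set.abs_projIcc_sub_projIcc zero_le_one).trans_lt ?_
      linarith
    rw [← dist_eq_norm]
    exact (dist_le_pi_dist (k s t) (k s' t) i).trans h1.le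
  have hcont : ∀ m, Continuous fun y : ℝ × I × ℂ => phiPush d h k m y.1 y.2.1 y.2.2 := by
    intro m
    induction m with
    | zero => exact continuous_snd.comp continuous_snd
    | succ m ih =>
      have := thetaPush_continuous d (Y := ℝ × I × ℂ)
        (u := fun y => k (min y.1 ((m+1 : ℕ) * h)) y.2.1) (v := fun y => k (min y.1 (m * h)) y.2.1)
        (z := fun y => y.2.2)
        (hkc.comp (f := fun y : ℝ × I × ℂ => (min y.1 ((m+1 : ℕ) * h), y.2.1)) (by fun_prop))
        (hkc.comp (f := fun y : ℝ × I × ℂ => (min y.1 (m * h), y.2.1)) (by fun_prop))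
        (by fun_prop)
      exact ih.comp (continuous_fst.prodMk ((continuous_fst.comp continuous_snd).prodMk this))
  have havoid : ∀ (m : ℕ) s t z, 0 ≤ s → (∀ i, z ≠ k (min s (m * h)) t i) →
      ∀ i, phiPush d h k m s t z ≠ p i := by
    intro m
    induction m with
    | zero =>
      intro s t z hs hz i
      have := hz i
      simpa [hk, hs, h0, phiPush] using this
    | succ m ih =>
      intro s t z hs hz i
      refine ih s t _ hs (fun j => ?_) i
      refine theta_inj d hd _ _ (fun i j hij => hsep _ i j hij) (fun i => ?_) z hz j
      apply hkclose
      refine (abs_min_sub_min_le_max _ _ _ _).trans ?_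
      rw [sub_self, abs_zero, max_eq_right (abs_nonneg _)]
      push_cast
      rw [show (m:ℝ) * h - (m+1) * h = -h by ring, abs_neg, abs_of_pos hh0]
  have hid : ∀ m s t z, (∀ s', s' ≤ s → k s' t = p) → phiPush d h k m s t z = z := by
    intro m
    induction m with
    | zero => intros; rfl
    | succ m ih =>
      intro s t z hs
      rw [phiPush, hs _ (min_le_left _ _), hs _ (min_le_left _ _), thetaPush_self]
      exact ih s t z hs
  have hfar : ∀ m s t z, (∀ s' j, d ≤ ‖z - k s' t j‖) → phiPush d h k m s t z = z := by
    intro m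
    induction m with
    | zero => intros; rfl
    | succ m ih =>
      intro s t z hs
      rw [phiPush, thetaPush_far d hd _ _ _ (hs _)]
      exact ih s t z hs
  have hR : ∀ x j, d ≤ ‖((M + d : ℝ) : ℂ) - K x j‖ := by
    intro x j
    have h1 := norm_sub_norm_le ((M + d : ℝ) : ℂ) (K x j)
    rw [Complex.norm_real, Real.norm_of_nonneg (by positivity)] at h1
    have := (norm_le_pi_norm (K x) j).trans (hM x)
    linarith
  refine ⟨fun s t z => phiPush d h k N s t z, ?_, ?_, ?_, ?_, ?_, ((M + d : ℝ) : ℂ), ?_, ?_⟩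
  · exact (hcont N).comp (f := fun y : I × I × ℂ => ((y.1 : ℝ), y.2.1, y.2.2)) (by fun_prop)
  · intro s t z hz i
    refine havoid N s t z s.2.1 ?_ i
    rw [min_eq_left (s.2.2.trans hNh)]
    simpa [hk] using hz
  · intro t z
    refine hid _ _ _ _ fun s' hs' => ?_
    have : Set.projIcc (0:ℝ) 1 zero_le_one s' = 0 := Set.projIcc_of_le_left _ hs'
    simp only [hk, this, h0]
  · exact fun s z => hid _ _ _ _ fun s' _ => hs0 _
  · exact fun s z => hid _ _ _ _ fun s' _ => hs1 _
  · intro i hi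
    have := hR (0, 0) i
    rw [h0, hi, sub_self, norm_zero] at this
    linarith
  · exact fun s t => hfar _ _ _ _ fun s' j => hR _ j

lemma square_homotopic {X : Type*} [TopologicalSpace X] (f : C(I × I, X)) {a b : I × I}
    (α β : Path a b) {x y : X} (P Q : Path x y) (hP : ∀ t, P t = f (α t))
    (hQ : ∀ t, Q t = f (β t)) : P.Homotopic Q := by
  have hx : x = f a := by rw [← P.source, hP, α.source]
  have hy : y = f b := by rw [← P.target, hP, α.target]
  subst hx hy
  have : ContractibleSpace I := (convex_Icc (0:ℝ) 1).contractibleSpace ⟨0, by simp⟩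
  have := (SimplyConnectedSpace.paths_homotopic α β).map f
  rwa [show P = α.map f.continuous from Path.ext (funext hP),
    show Q = β.map f.continuous from Path.ext (funext hQ)]

lemma trans_eq_map {X Y : Type*} [TopologicalSpace X] [TopologicalSpace Y] (f : Y → X)
    {a b c : Y} (α : Path a b) (β : Path b c) {x y z : X} (P : Path x y) (Q : Path y z)
    (hP : ∀ t, P t = f (α t)) (hQ : ∀ t, Q t = f (β t)) (t : I) :
    P.trans Q t = f (α.trans β t) := by
  rw [Path.trans_apply, Path.trans_apply]
  split_ifs
  · exact hP _
  · exact hQ _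

/-- horizontal segment -/
def hseg (s : I) : Path ((0, s) : I × I) (1, s) where
  toFun t := (t, s)
  continuous_toFun := by fun_prop
  source' := rfl
  target' := rfl
/-- vertical segment -/
def vseg (t : I) : Path ((t, 0) : I × I) (t, 1) where
  toFun s := (t, s)
  continuous_toFun := by fun_prop
  source' := rfl
  target' := rfl
/-- diagonal segment -/
def dseg : Path ((0, 0) : I × I) (1, 1) where
  toFun s := (s, s)
  continuous_toFun := by fun_prop
  source' := rfl
  target' := rfl

/-- A loop of self-maps fixing a point `R` acts trivially on loops. -/
lemma loop_action {X : Type*} [TopologicalSpace X] [PathConnectedSpace X] (Ψ : I × X → X)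
    (hΨ : Continuous Ψ) (h0 : ∀ x, Ψ (0, x) = x) (h1 : ∀ x, Ψ (1, x) = x) (R : X)
    (hR : ∀ t, Ψ (t, R) = R) (q : X) (γ γ' : Path q q) (hγ : ∀ t, γ' t = Ψ (t, γ t)) :
    γ'.Homotopic γ := by
  let lam : Path q q := ⟨⟨fun t => Ψ (t, q), by fun_prop⟩, h0 q, h1 q⟩
  have e1 : γ'.Homotopic (lam.trans γ) := by
    refine square_homotopic ⟨fun y => Ψ (y.1, γ y.2), by fun_prop⟩ dseg ((hseg 0).trans (vseg 1))
      _ _ hγ (trans_eq_map _ _ _ _ _ (fun t => ?_) (fun t => ?_))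
    · simp [lam, hseg]
    · simp [vseg, h1]
  obtain ⟨δ⟩ := PathConnectedSpace.joined R q
  have e2 : ((Path.refl R).trans δ).Homotopic (δ.trans lam) := by
    refine square_homotopic ⟨fun y => Ψ (y.1, δ y.2), by fun_prop⟩ ((hseg 0).trans (vseg 1))
      ((vseg 0).trans (hseg 1))
      _ _ (trans_eq_map _ _ _ _ _ (fun t => ?_) (fun t => ?_))
      (trans_eq_map _ _ _ _ _ (fun t => ?_) (fun t => ?_))
    · simp [hseg, hR]
    · simp [vseg, h1]
    · simp [vseg, h0]
    · simp [lam, hseg]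
  have e3 : lam.Homotopic (Path.refl q) := by
    have a1 : δ.Homotopic (δ.trans lam) :=
      (Path.Homotopic.symm ⟨Path.Homotopy.reflTrans δ⟩).symm.symm.trans e2
    have a2 := (Path.Homotopic.refl δ.symm).hcomp a1
    have a3 : (δ.symm.trans δ).Homotopic (Path.refl q) :=
      Path.Homotopic.symm ⟨Path.Homotopy.reflSymmTrans δ⟩
    have a4 : ((δ.symm.trans δ).trans lam).Homotopic (δ.symm.trans (δ.trans lam)) :=
      ⟨Path.Homotopy.transAssoc _ _ _⟩
    have a5 : lam.Homotopic ((Path.refl q).trans lam) :=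
      Path.Homotopic.symm ⟨Path.Homotopy.reflTrans lam⟩
    exact a5.trans (((a3.symm.hcomp (.refl lam)).trans a4).trans (a2.symm.trans a3))
  exact e1.trans ((e3.hcomp (.refl γ)).trans ⟨Path.Homotopy.reflTrans γ⟩)



/-- The ordered configuration space of `n` points of `ℂ`. -/
abbrev ConfC (n : ℕ) : Type :=
  {f : Fin n → ℂ // ∀ i j : Fin n, i ≠ j → f i ≠ f j}

/-- The inclusion of the fiber `ℂ ∖ {p₁,…,pₙ}` of the projection
`C_{n+1}(ℂ) → C_n(ℂ)` over `(p₁,…,pₙ)`, sending `z` to `(p₁,…,pₙ,z)`. -/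
def fiberIncl (n : ℕ) (p : Fin n → ℂ) (hp : ∀ i j : Fin n, i ≠ j → p i ≠ p j)
    (z : {w : ℂ // ∀ i, w ≠ p i}) : ConfC (n + 1) :=
  ⟨Fin.snoc p (z : ℂ), by
    intro i j hij
    induction i using Fin.lastCases with
    | last =>
      induction j using Fin.lastCases with
      | last => exact absurd rfl hij
      | cast j => simpa using z.2 j
    | cast i =>
      induction j using Fin.lastCases with
      | last => simpa using Ne.symm (z.2 i)
      | cast j =>
        simp only [Fin.snoc_castSucc]
        exact hp i j fun h => hij (by rw [h])⟩

theorem fiberIncl_continuous (n : ℕ) (p : Fin n → ℂ)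
    (hp : ∀ i j : Fin n, i ≠ j → p i ≠ p j) :
    Continuous (fiberIncl n p hp) := by
  apply Continuous.subtype_mk
  apply continuous_pi
  intro i
  induction i using Fin.lastCases with
  | last => simpa using continuous_subtype_val
  | cast i => simpa using continuous_const

/-- The inclusion of the fiber `ℂ ∖ {p₁,…,pₙ}` into `C_{n+1}(ℂ)` induces an
injective homomorphism on fundamental groups: two loops in the fiber based at
`q` whose images are path-homotopic in `C_{n+1}(ℂ)` are already path-homotopic
in the fiber. -/
theorem stmt_8 (n : ℕ) (p : Fin n → ℂ) (hp : ∀ i j : Fin n, i ≠ j → p i ≠ p j)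
    (q : {w : ℂ // ∀ i, w ≠ p i}) (γ₁ γ₂ : Path q q) :
    Path.Homotopic (γ₁.map (fiberIncl_continuous n p hp))
      (γ₂.map (fiberIncl_continuous n p hp)) → Path.Homotopic γ₁ γ₂ := by
  rintro ⟨H⟩
  have hHc : Continuous fun x => (H x : Fin (n+1) → ℂ) := continuous_subtype_val.comp H.continuous
  have hb : ∀ (x : I × I) (z : {w : ℂ // ∀ i, w ≠ p i}), H x = fiberIncl n p hp z →
      (fun i : Fin n => (H x : Fin (n+1) → ℂ) i.castSucc) = p ∧
      (H x : Fin (n+1) → ℂ) (Fin.last n) = z := by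
    intro x z h
    rw [h]
    constructor
    · funext i; simp [fiberIncl]
    · simp [fiberIncl]
  have b0 : ∀ t, H (0, t) = fiberIncl n p hp (γ₁ t) := fun t => by simp
  have b1 : ∀ t, H (1, t) = fiberIncl n p hp (γ₂ t) := fun t => by simp
  have b2 : ∀ s, H (s, 0) = fiberIncl n p hp q := fun t => by simp
  have b3 : ∀ s, H (s, 1) = fiberIncl n p hp q := fun t => by simp
  obtain ⟨Φ, hΦc, hΦ, hΦ0, hΦs0, hΦs1, R, hR, hΦR⟩ := transport p
    (fun x i => (H x : Fin (n+1) → ℂ) i.castSucc)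
    (continuous_pi fun i => (continuous_apply _).comp hHc)
    (fun x i j hij => (H x).2 _ _ (by simpa using hij))
    (fun t => (hb _ _ (b0 t)).1) (fun t => (hb _ _ (b2 t)).1) (fun t => (hb _ _ (b3 t)).1)
  have : PathConnectedSpace {w : ℂ // ∀ i, w ≠ p i} := by
    have := (Set.countable_range p).isPathConnected_compl_of_one_lt_rank
      (by rw [Complex.rank_real_complex]; norm_num)
    have h2 : (Set.range p)ᶜ = {w : ℂ | ∀ i, w ≠ p i} := by
      ext w; simp [eq_comm]
    rw [h2] at this
    exact isPathConnected_iff_pathConnectedSpace.1 this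
  have hz : ∀ (t : I) (z : {w : ℂ // ∀ i, w ≠ p i}) i, Φ 1 t z ≠ p i := fun t z =>
    hΦ 1 t z (fun i => by
      have := congrFun (hb _ _ (b1 t)).1 i
      rw [this]; exact z.2 i)
  let Ψ : I × {w : ℂ // ∀ i, w ≠ p i} → {w : ℂ // ∀ i, w ≠ p i} :=
    fun y => ⟨Φ 1 y.1 y.2, hz y.1 y.2⟩
  have hΨ : Continuous Ψ :=
    (hΦc.comp (f := fun y : I × {w : ℂ // ∀ i, w ≠ p i} => ((1:I), y.1, (y.2 : ℂ)))
      (by fun_prop)).subtype_mk _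
  let γ' : Path q q := ⟨⟨fun t => Ψ (t, γ₂ t), by fun_prop⟩,
    by simp [Ψ, hΦs0], by simp [Ψ, hΦs1]⟩
  have key : γ'.Homotopic γ₂ := loop_action Ψ hΨ (fun x => Subtype.ext (hΦs0 _ _))
    (fun x => Subtype.ext (hΦs1 _ _)) ⟨R, hR⟩ (fun t => Subtype.ext (hΦR _ _)) q γ₂ γ'
    (fun t => rfl)
  refine Path.Homotopic.trans ?_ key
  have hG : ∀ x : I × I, ∀ i, Φ x.1 x.2 ((H x : Fin (n+1) → ℂ) (Fin.last n)) ≠ p i := fun x =>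
    hΦ x.1 x.2 _ (fun i => (H x).2 _ _ (Fin.castSucc_lt_last i).ne')
  have hGc : Continuous fun x : I × I => Φ x.1 x.2 ((H x : Fin (n+1) → ℂ) (Fin.last n)) :=
    hΦc.comp (continuous_fst.prodMk (continuous_snd.prodMk ((continuous_apply _).comp hHc)))
  refine ⟨⟨⟨⟨fun x => ⟨_, hG x⟩, hGc.subtype_mk _⟩, fun t => Subtype.ext ?_,
    fun t => Subtype.ext ?_⟩, ?_⟩⟩
  · change Φ 0 t _ = _
    rw [hΦ0, (hb _ _ (b0 t)).2]; rfl
  · change Φ 1 t _ = Φ 1 t _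
    rw [(hb _ _ (b1 t)).2]
  · rintro s t (rfl | rfl)
    · refine Subtype.ext ?_
      change Φ s 0 _ = (γ₁ 0 : ℂ)
      rw [hΦs0, (hb _ _ (b2 s)).2, γ₁.source]
    · refine Subtype.ext ?_
      change Φ s 1 _ = (γ₁ 1 : ℂ)
      rw [hΦs1, (hb _ _ (b3 s)).2, γ₁.target]
end

section
/- The antipodal orbit configuration space C₂^±(S²) = {(x,y) ∈ S² × S² : y ≠ x and y ≠ −x} is homotopy equivalent to the rotation group SO(3) (the special orthogonal group of 3×3 real matrices, with its topology as a subspace of the space of matrices); equivalently, it is homotopy equivalent to the real projective space ℝP³. -/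
/-- The unit 2-sphere in euclidean 3-space. -/
abbrev TwoSphere : Set (EuclideanSpace ℝ (Fin 3)) :=
  Metric.sphere (0 : EuclideanSpace ℝ (Fin 3)) 1

/-- The antipodal orbit configuration space
`C₂^±(S²) = {(x, y) ∈ S² × S² : y ≠ x and y ≠ -x}`. -/
abbrev AntipodalConfTwo : Type :=
  {p : ↥TwoSphere × ↥TwoSphere // p.2 ≠ p.1 ∧ p.2 ≠ -p.1}

/-- The rotation group `SO(3)`, as a subspace of the space of `3 × 3` real
matrices. -/
abbrev SO3 : Type :=
  {A : Matrix (Fin 3) (Fin 3) ℝ // A ∈ Matrix.orthogonalGroup (Fin 3) ℝ ∧ A.det = 1}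

/-- The unit 3-sphere in euclidean 4-space. -/
abbrev ThreeSphere : Set (EuclideanSpace ℝ (Fin 4)) :=
  Metric.sphere (0 : EuclideanSpace ℝ (Fin 4)) 1

/-- The antipodal equivalence relation on the 3-sphere. -/
def antipodalSetoid : Setoid ↥ThreeSphere where
  r x y := x = y ∨ x = -y
  iseqv := by
    refine ⟨fun x => Or.inl rfl, ?_, ?_⟩
    · rintro x y (rfl | rfl)
      · exact Or.inl rfl
      · exact Or.inr (by simp)
    · rintro x y z (rfl | rfl) h
      · exact h
      · rcases h with rfl | rfl
        · exact Or.inr rfl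
        · exact Or.inl (by simp)

/-- The real projective space `ℝP³`, as the quotient of the 3-sphere by the
antipodal action. -/
abbrev RP3 : Type := Quotient antipodalSetoid

namespace S10

abbrev E3 := EuclideanSpace ℝ (Fin 3)

lemma norm_one_iff (x : E3) : ‖x‖ = 1 ↔ x 0 ^ 2 + x 1 ^ 2 + x 2 ^ 2 = 1 := by
  rw [EuclideanSpace.norm_eq, Real.sqrt_eq_one]
  simp [Fin.sum_univ_three]

noncomputable def w (t : ℝ) (x y : E3) : E3 := y - (t * inner ℝ x y) • x

noncomputable def nw (t : ℝ) (x y : E3) : E3 := ‖w t x y‖⁻¹ • w t x y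

lemma noncol (p : AntipodalConfTwo) (c : ℝ) : (p.1.2 : E3) ≠ c • (p.1.1 : E3) := by
  intro h
  have h1 : ‖(p.1.1 : E3)‖ = 1 := by simpa using p.1.1.2
  have h2 : ‖(p.1.2 : E3)‖ = 1 := by simpa using p.1.2.2
  rw [h, norm_smul, h1, mul_one, Real.norm_eq_abs] at h2
  rcases abs_eq (zero_le_one) |>.1 h2 with rfl | rfl
  · exact p.2.1 (Subtype.ext (by simpa using h))
  · exact p.2.2 (Subtype.ext (by simpa using h))

lemma w_ne (t : ℝ) (p : AntipodalConfTwo) : w t p.1.1 p.1.2 ≠ 0 := by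
  intro h
  exact noncol p _ (sub_eq_zero.1 h)

lemma nw_norm (t : ℝ) (p : AntipodalConfTwo) : ‖nw t p.1.1 p.1.2‖ = 1 := by
  rw [nw, norm_smul, norm_inv, norm_norm, inv_mul_cancel₀ (norm_ne_zero_iff.2 (w_ne t p))]

lemma nw_ne (t c : ℝ) (p : AntipodalConfTwo) : nw t p.1.1 p.1.2 ≠ c • (p.1.1 : E3) := by
  intro h
  have h0 : ‖w t p.1.1 p.1.2‖ ≠ 0 := (norm_ne_zero_iff.2 (w_ne t p))
  have h1 : w t p.1.1 p.1.2 = (‖w t p.1.1 p.1.2‖ * c) • (p.1.1 : E3) := by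
    rw [mul_smul, ← h, nw, smul_inv_smul₀ h0]
  generalize ‖w t p.1.1 p.1.2‖ * c = d at h1
  apply noncol p (d + t * inner ℝ (p.1.1 : E3) (p.1.2 : E3))
  rw [add_smul, ← h1, w]
  abel

lemma nw_cont : Continuous (fun q : ℝ × AntipodalConfTwo => nw q.1 q.2.1.1 q.2.1.2) := by
  have : Continuous (fun q : ℝ × AntipodalConfTwo => w q.1 q.2.1.1 q.2.1.2) := by
    unfold w
    fun_prop
  unfold nw
  exact (this.norm.inv₀ (fun q => norm_ne_zero_iff.2 (w_ne q.1 q.2))).smul this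

noncomputable def push (t : ℝ) (p : AntipodalConfTwo) : AntipodalConfTwo :=
  ⟨(p.1.1, ⟨nw t p.1.1 p.1.2, by simpa using nw_norm t p⟩),
    fun h => nw_ne t 1 p (by simpa using congrArg Subtype.val h),
    fun h => nw_ne t (-1) p (by simpa using congrArg Subtype.val h)⟩

lemma push_cont : Continuous (fun q : ℝ × AntipodalConfTwo => push q.1 q.2) := by
  unfold push
  refine Continuous.subtype_mk (Continuous.prodMk (by fun_prop) ?_) _
  exact Continuous.subtype_mk nw_cont _

lemma push_zero (p : AntipodalConfTwo) : push 0 p = p := by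
  have h2 : ‖(p.1.2 : E3)‖ = 1 := by simpa using p.1.2.2
  apply Subtype.ext
  apply Prod.ext
  · rfl
  · apply Subtype.ext
    simp [push, nw, w, h2]

lemma inner_nw (p : AntipodalConfTwo) : inner ℝ (p.1.1 : E3) (nw 1 p.1.1 p.1.2) = 0 := by
  have h1 : ‖(p.1.1 : E3)‖ = 1 := by simpa using p.1.1.2
  rw [nw, inner_smul_right, w, inner_sub_right, inner_smul_right, real_inner_self_eq_norm_sq, h1]
  simp

def frame (x u : E3) : Matrix (Fin 3) (Fin 3) ℝ :=
  !![x 0, x 1, x 2; u 0, u 1, u 2;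
    x 1 * u 2 - x 2 * u 1, x 2 * u 0 - x 0 * u 2, x 0 * u 1 - x 1 * u 0]

lemma frame_mem (x u : E3) (hx : ‖x‖ = 1) (hu : ‖u‖ = 1) (h : inner ℝ x u = 0) :
    frame x u ∈ Matrix.orthogonalGroup (Fin 3) ℝ ∧ (frame x u).det = 1 := by
  rw [norm_one_iff] at hx hu
  rw [PiLp.inner_apply] at h
  simp [Fin.sum_univ_three] at h
  have key : (x 1 * u 2 - x 2 * u 1)^2 + (x 2 * u 0 - x 0 * u 2)^2 + (x 0 * u 1 - x 1 * u 0)^2 = 1 := by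
    linear_combination (u 0 ^ 2 + u 1 ^ 2 + u 2 ^ 2) * hx + hu
      - (u 0 * x 0 + u 1 * x 1 + u 2 * x 2) * h
  constructor
  · rw [Matrix.mem_orthogonalGroup_iff]
    ext i j
    fin_cases i <;> fin_cases j <;>
      simp [frame, Matrix.mul_apply, Fin.sum_univ_three]
    all_goals first
      | ring1
      | linear_combination hx
      | linear_combination hu
      | linear_combination h
      | linear_combination key
  · rw [Matrix.det_fin_three]
    simp [frame]
    linear_combination key

noncomputable def F (p : AntipodalConfTwo) : SO3 :=
  ⟨frame p.1.1 (nw 1 p.1.1 p.1.2),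
    frame_mem _ _ (by simpa using p.1.1.2) (nw_norm 1 p) (inner_nw p)⟩

lemma frame_cont : Continuous (fun p : E3 × E3 => frame p.1 p.2) := by
  refine continuous_matrix fun i j => ?_
  fin_cases i <;> fin_cases j <;> simp [frame] <;> fun_prop

lemma F_cont : Continuous F := by
  have h : Continuous (fun p : AntipodalConfTwo => nw 1 p.1.1 p.1.2) := by
    have h0 : Continuous (fun p : AntipodalConfTwo => ((1 : ℝ), p)) := by fun_prop
    have h1 := nw_cont.comp h0
    simp only [Function.comp_def] at h1
    exact h1
  have h' : Continuous (fun p : AntipodalConfTwo => (p.1.1 : E3)) := by fun_prop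
  have h2 := frame_cont.comp (h'.prodMk h)
  simp only [Function.comp_def] at h2
  exact Continuous.subtype_mk h2 _

structure Rel (A : Matrix (Fin 3) (Fin 3) ℝ) : Prop where
  r00 : A 0 0 ^ 2 + A 0 1 ^ 2 + A 0 2 ^ 2 = 1
  r11 : A 1 0 ^ 2 + A 1 1 ^ 2 + A 1 2 ^ 2 = 1
  r22 : A 2 0 ^ 2 + A 2 1 ^ 2 + A 2 2 ^ 2 = 1
  r01 : A 0 0 * A 1 0 + A 0 1 * A 1 1 + A 0 2 * A 1 2 = 0
  r02 : A 0 0 * A 2 0 + A 0 1 * A 2 1 + A 0 2 * A 2 2 = 0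
  r12 : A 1 0 * A 2 0 + A 1 1 * A 2 1 + A 1 2 * A 2 2 = 0
  c00 : A 0 0 ^ 2 + A 1 0 ^ 2 + A 2 0 ^ 2 = 1
  c11 : A 0 1 ^ 2 + A 1 1 ^ 2 + A 2 1 ^ 2 = 1
  c22 : A 0 2 ^ 2 + A 1 2 ^ 2 + A 2 2 ^ 2 = 1
  c01 : A 0 0 * A 0 1 + A 1 0 * A 1 1 + A 2 0 * A 2 1 = 0
  c02 : A 0 0 * A 0 2 + A 1 0 * A 1 2 + A 2 0 * A 2 2 = 0
  c12 : A 0 1 * A 0 2 + A 1 1 * A 1 2 + A 2 1 * A 2 2 = 0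
  a00 : A 0 0 = A 1 1 * A 2 2 - A 1 2 * A 2 1
  a01 : A 0 1 = A 1 2 * A 2 0 - A 1 0 * A 2 2
  a02 : A 0 2 = A 1 0 * A 2 1 - A 1 1 * A 2 0
  a10 : A 1 0 = A 2 1 * A 0 2 - A 2 2 * A 0 1
  a11 : A 1 1 = A 2 2 * A 0 0 - A 2 0 * A 0 2
  a12 : A 1 2 = A 2 0 * A 0 1 - A 2 1 * A 0 0
  a20 : A 2 0 = A 0 1 * A 1 2 - A 0 2 * A 1 1
  a21 : A 2 1 = A 0 2 * A 1 0 - A 0 0 * A 1 2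
  a22 : A 2 2 = A 0 0 * A 1 1 - A 0 1 * A 1 0

lemma rel (A : SO3) : Rel A.1 := by
  obtain ⟨A, hA, hd⟩ := A
  have h1 := (Matrix.mem_orthogonalGroup_iff _ _).1 hA
  have h2 := (Matrix.mem_orthogonalGroup_iff' _ _).1 hA
  have h3 : A.transpose = A.adjugate := by
    have := A.adjugate_mul
    rw [hd, one_smul] at this
    calc A.transpose = (A.adjugate * A) * A.transpose := by rw [this, one_mul]
      _ = A.adjugate * (A * A.transpose) := by rw [Matrix.mul_assoc]
      _ = _ := by
        have h1' : A * A.transpose = 1 := h1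
        rw [h1', mul_one]
  have e1 := fun i j => congrFun (congrFun h1 i) j
  have e2 := fun i j => congrFun (congrFun h2 i) j
  have e3 := fun i j => congrFun (congrFun h3 j) i
  simp only [Matrix.mul_apply, Fin.sum_univ_three, Matrix.star_apply, star_trivial,
    Matrix.adjugate_fin_three, Matrix.transpose_apply] at e1 e2 e3
  constructor
  · simpa [sq] using e1 0 0
  · simpa [sq] using e1 1 1
  · simpa [sq] using e1 2 2
  · simpa using e1 0 1
  · simpa using e1 0 2
  · simpa using e1 1 2
  · simpa [sq] using e2 0 0
  · simpa [sq] using e2 1 1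
  · simpa [sq] using e2 2 2
  · simpa using e2 0 1
  · simpa using e2 0 2
  · simpa using e2 1 2
  · have := e3 0 0; simp at this; linarith
  · have := e3 0 1; simp at this; linarith
  · have := e3 0 2; simp at this; linarith
  · have := e3 1 0; simp at this; linarith
  · have := e3 1 1; simp at this; linarith
  · have := e3 1 2; simp at this; linarith
  · have := e3 2 0; simp at this; linarith
  · have := e3 2 1; simp at this; linarith
  · have := e3 2 2; simp at this; linarith

def row (A : Matrix (Fin 3) (Fin 3) ℝ) (i : Fin 3) : E3 := WithLp.toLp 2 (A i)

lemma row_inner (A : SO3) : inner ℝ (row A.1 0) (row A.1 1) = 0 := by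
  have := (rel A).r01
  rw [PiLp.inner_apply]
  simp [Fin.sum_univ_three, row]
  linarith

lemma row_norm0 (A : SO3) : ‖row A.1 0‖ = 1 := (norm_one_iff _).2 (rel A).r00
lemma row_norm1 (A : SO3) : ‖row A.1 1‖ = 1 := (norm_one_iff _).2 (rel A).r11

def G (A : SO3) : AntipodalConfTwo :=
  ⟨(⟨row A.1 0, by simpa using row_norm0 A⟩, ⟨row A.1 1, by simpa using row_norm1 A⟩), by
    have h := row_inner A
    have h0 := row_norm0 A
    constructor
    · intro e
      have e' : row A.1 1 = row A.1 0 := congrArg Subtype.val e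
      rw [e', real_inner_self_eq_norm_sq, h0] at h
      norm_num at h
    · intro e
      have e' : row A.1 1 = - row A.1 0 := congrArg Subtype.val e
      rw [e', inner_neg_right, real_inner_self_eq_norm_sq, h0] at h
      norm_num at h⟩

lemma G_cont : Continuous G := by
  have h : ∀ i, Continuous (fun A : SO3 => row A.1 i) := by
    intro i
    unfold row
    refine (PiLp.continuous_toLp 2 _).comp ?_
    exact (continuous_apply i).comp continuous_subtype_val
  exact Continuous.subtype_mk (Continuous.prodMk (Continuous.subtype_mk (h 0) _)
    (Continuous.subtype_mk (h 1) _)) _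

lemma FG (A : SO3) : F (G A) = A := by
  have h : nw 1 (G A).1.1 (G A).1.2 = row A.1 1 := by
    change nw 1 (row A.1 0) (row A.1 1) = row A.1 1
    simp [nw, w, row_inner, row_norm1]
  have r := rel A
  apply Subtype.ext
  change frame (row A.1 0) (nw 1 (G A).1.1 (G A).1.2) = A.1
  rw [h]
  ext i j
  fin_cases i <;> fin_cases j <;> simp [frame, row]
  · exact r.a20.symm
  · exact r.a21.symm
  · exact r.a22.symm

lemma GF (p : AntipodalConfTwo) : G (F p) = push 1 p := by
  apply Subtype.ext
  apply Prod.ext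
  · apply Subtype.ext
    ext i
    fin_cases i <;> simp [G, F, row, push, frame]
  · apply Subtype.ext
    ext i
    fin_cases i <;> simp [G, F, row, push, frame]

noncomputable def equivSO3 : ContinuousMap.HomotopyEquiv AntipodalConfTwo SO3 where
  toFun := ⟨F, F_cont⟩
  invFun := ⟨G, G_cont⟩
  left_inv := ⟨ContinuousMap.Homotopy.symm
    { toFun := fun q => push (q.1 : ℝ) q.2
      continuous_toFun := push_cont.comp
        (Continuous.prodMk (continuous_subtype_val.comp continuous_fst) continuous_snd)
      map_zero_left := fun p => by simp [push_zero]
      map_one_left := fun p => by simp [GF] }⟩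
  right_inv := by
    have : (ContinuousMap.comp ⟨F, F_cont⟩ ⟨G, G_cont⟩ : C(SO3, SO3)) = ContinuousMap.id _ := by
      ext1 A
      exact FG A
    rw [this]

def rot (q : Fin 4 → ℝ) : Matrix (Fin 3) (Fin 3) ℝ :=
  !![q 0 * q 0 + q 1 * q 1 - q 2 * q 2 - q 3 * q 3, 2 * (q 1 * q 2) - 2 * (q 0 * q 3), 2 * (q 1 * q 3) + 2 * (q 0 * q 2);
     2 * (q 1 * q 2) + 2 * (q 0 * q 3), q 0 * q 0 - q 1 * q 1 + q 2 * q 2 - q 3 * q 3, 2 * (q 2 * q 3) - 2 * (q 0 * q 1);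
     2 * (q 1 * q 3) - 2 * (q 0 * q 2), 2 * (q 2 * q 3) + 2 * (q 0 * q 1), q 0 * q 0 - q 1 * q 1 - q 2 * q 2 + q 3 * q 3]

def K (A : Matrix (Fin 3) (Fin 3) ℝ) : Matrix (Fin 4) (Fin 4) ℝ :=
  !![1 + A 0 0 + A 1 1 + A 2 2, A 2 1 - A 1 2, A 0 2 - A 2 0, A 1 0 - A 0 1;
     A 2 1 - A 1 2, 1 + A 0 0 - A 1 1 - A 2 2, A 0 1 + A 1 0, A 0 2 + A 2 0;
     A 0 2 - A 2 0, A 0 1 + A 1 0, 1 - A 0 0 + A 1 1 - A 2 2, A 1 2 + A 2 1;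
     A 1 0 - A 0 1, A 0 2 + A 2 0, A 1 2 + A 2 1, 1 - A 0 0 - A 1 1 + A 2 2]

lemma norm_one_iff4 (x : EuclideanSpace ℝ (Fin 4)) :
    ‖x‖ = 1 ↔ x 0 ^ 2 + x 1 ^ 2 + x 2 ^ 2 + x 3 ^ 2 = 1 := by
  rw [EuclideanSpace.norm_eq, Real.sqrt_eq_one]
  simp [Fin.sum_univ_four]

lemma rot_mem (q : Fin 4 → ℝ) (h : q 0 ^ 2 + q 1 ^ 2 + q 2 ^ 2 + q 3 ^ 2 = 1) :
    rot q ∈ Matrix.orthogonalGroup (Fin 3) ℝ ∧ (rot q).det = 1 := by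
  constructor
  · rw [Matrix.mem_orthogonalGroup_iff]
    ext i j
    fin_cases i <;> fin_cases j <;>
      simp [rot, Matrix.mul_apply, Fin.sum_univ_three]
    all_goals first
      | ring1
      | linear_combination (q 0 ^ 2 + q 1 ^ 2 + q 2 ^ 2 + q 3 ^ 2 + 1) * h
  · rw [Matrix.det_fin_three]
    simp [rot]
    set n := q 0 ^ 2 + q 1 ^ 2 + q 2 ^ 2 + q 3 ^ 2 with hn
    have : n ^ 3 = 1 := by rw [h]; norm_num
    rw [hn] at this
    linear_combination this

lemma K_rot (q : Fin 4 → ℝ) (h : q 0 ^ 2 + q 1 ^ 2 + q 2 ^ 2 + q 3 ^ 2 = 1) (i j : Fin 4) :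
    K (rot q) i j = 4 * (q i * q j) := by
  fin_cases i <;> fin_cases j <;> simp [K, rot] <;> grind

lemma K_rank (A : SO3) (i j k : Fin 4) :
    K A.1 i j * K A.1 i k = K A.1 i i * K A.1 j k := by
  obtain ⟨r00, r11, r22, r01, r02, r12, c00, c11, c22, c01, c02, c12,
    a00, a01, a02, a10, a11, a12, a20, a21, a22⟩ := rel A
  fin_cases i <;> fin_cases j <;> fin_cases k <;> simp [K] <;> grind

lemma rot_surj (A : SO3) : ∃ q : Fin 4 → ℝ, q 0 ^ 2 + q 1 ^ 2 + q 2 ^ 2 + q 3 ^ 2 = 1 ∧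
    rot q = A.1 := by
  have hi : ∃ i, 0 < K A.1 i i := by
    by_contra! hc
    have h0 := hc 0
    have h1 := hc 1
    have h2 := hc 2
    have h3 := hc 3
    simp [K] at h0 h1 h2 h3
    linarith
  obtain ⟨i, hi⟩ := hi
  set s := Real.sqrt (K A.1 i i) with hs
  have hs2 : s * s = K A.1 i i := Real.mul_self_sqrt hi.le
  have hs0 : s ≠ 0 := (Real.sqrt_pos.2 hi).ne'
  have hq : ∀ j k, (K A.1 i j / (2 * s)) * (K A.1 i k / (2 * s)) = K A.1 j k / 4 := by
    intro j k
    have := K_rank A i j k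
    field_simp
    rw [this, ← hs2]
    ring
  refine ⟨fun j => K A.1 i j / (2 * s), ?_, ?_⟩
  · simp only [sq, hq]
    simp [K]
    ring
  · ext a b
    fin_cases a <;> fin_cases b <;> simp [rot, hq] <;> simp [K] <;> ring

def R (x : ↥ThreeSphere) : SO3 :=
  ⟨rot x.1, rot_mem _ ((norm_one_iff4 x.1).1 (by simpa using x.2))⟩

lemma R_cont : Continuous R := by
  unfold R
  refine Continuous.subtype_mk ?_ _
  refine continuous_matrix fun i j => ?_
  fin_cases i <;> fin_cases j <;> simp [rot] <;> fun_prop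

lemma R_iff (x y : ↥ThreeSphere) : R x = R y ↔ (x = y ∨ x = -y) := by
  constructor
  · intro h
    have hx := (norm_one_iff4 x.1).1 (by simpa using x.2)
    have hy := (norm_one_iff4 y.1).1 (by simpa using y.2)
    have h' : rot x.1 = rot y.1 := congrArg Subtype.val h
    have hk : ∀ i j, x.1 i * x.1 j = y.1 i * y.1 j := by
      intro i j
      have h1 := K_rot _ hx i j
      rw [h', K_rot _ hy i j] at h1
      linarith
    have hi : ∃ i, x.1 i ≠ 0 := by
      by_contra! hc
      simp [hc] at hx
    obtain ⟨i, hi⟩ := hi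
    rcases mul_self_eq_mul_self_iff.1 (hk i i) with e | e
    · left
      apply Subtype.ext
      ext j
      apply mul_left_cancel₀ hi
      rw [hk, e]
    · right
      apply Subtype.ext
      ext j
      apply mul_left_cancel₀ hi
      rw [hk, e]
      simp
  · rintro (rfl | rfl)
    · rfl
    · apply Subtype.ext
      ext i j
      fin_cases i <;> fin_cases j <;> simp [R, rot]

def Rbar : RP3 → SO3 := Quotient.lift R (fun x y h => (R_iff x y).2 h)

lemma Rbar_cont : Continuous Rbar := R_cont.quotient_lift _

lemma Rbar_bij : Function.Bijective Rbar := by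
  constructor
  · intro a b
    induction a using Quotient.inductionOn with | _ a
    induction b using Quotient.inductionOn with | _ b
    intro h
    exact Quotient.sound ((R_iff a b).1 h)
  · intro A
    obtain ⟨q, h1, h2⟩ := rot_surj A
    refine ⟨Quotient.mk _ ⟨WithLp.toLp 2 q, ?_⟩, ?_⟩
    · have := (norm_one_iff4 (WithLp.toLp 2 q)).2 h1
      simpa using this
    · exact Subtype.ext h2

noncomputable def homeo : RP3 ≃ₜ SO3 :=
  haveI : CompactSpace ↥ThreeSphere := isCompact_iff_compactSpace.1 (isCompact_sphere _ _)
  haveI : CompactSpace RP3 := Quotient.compactSpace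
  (isHomeomorph_iff_continuous_bijective.2 ⟨Rbar_cont, Rbar_bij⟩).homeomorph

end S10

/-- The antipodal orbit configuration space `C₂^±(S²)` is homotopy equivalent to
the rotation group `SO(3)`; equivalently, to the real projective space `ℝP³`. -/
theorem stmt_10 :
    Nonempty (ContinuousMap.HomotopyEquiv AntipodalConfTwo SO3) ∧
    Nonempty (ContinuousMap.HomotopyEquiv AntipodalConfTwo RP3) := by
  exact ⟨⟨S10.equivSO3⟩, ⟨S10.equivSO3.trans S10.homeo.symm.toHomotopyEquiv⟩⟩
end

section
/- The configuration space C₃(ℙ¹) of three ordered pairwise-distinct points on the Riemann sphere ℙ¹ = ℂ ∪ {∞} (the one-point compactification of ℂ) is homotopy equivalent to the rotation group SO(3) (the special orthogonal group of 3×3 real matrices, with its topology as a subspace of the space of matrices); equivalently, it is homotopy equivalent to the real projective space ℝP³. -/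
/-- The Riemann sphere `ℙ¹ = ℂ ∪ {∞}`, the one-point compactification of `ℂ`. -/
abbrev RiemannSphere : Type := OnePoint ℂ

/-- The configuration space `C₃(ℙ¹)` of three ordered pairwise-distinct points
of the Riemann sphere. -/
abbrev ConfThreeP1 : Type :=
  {f : Fin 3 → RiemannSphere // ∀ i j : Fin 3, i ≠ j → f i ≠ f j}

open scoped InnerProductSpace

section stereo
variable {E : Type*} [NormedAddCommGroup E] [InnerProductSpace ℝ E]

noncomputable def stp (c a : E) : E := (1 - ⟪a, c⟫_ℝ)⁻¹ • (a - ⟪a, c⟫_ℝ • c)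
noncomputable def sti (c p : E) : E := (⟪p, p⟫_ℝ + 1)⁻¹ • ((2:ℝ) • p + (⟪p, p⟫_ℝ - 1) • c)

lemma one_sub_ne {c a : E} (hc : ⟪c, c⟫_ℝ = 1) (ha : ⟪a, a⟫_ℝ = 1) (h : a ≠ c) :
    1 - ⟪a, c⟫_ℝ ≠ 0 := by
  intro h0
  apply h
  rw [← sub_eq_zero, ← inner_self_eq_zero (𝕜 := ℝ), inner_sub_left, inner_sub_right,
    inner_sub_right, real_inner_comm a c, hc, ha]
  linarith

lemma stp_perp {c a : E} (hc : ⟪c, c⟫_ℝ = 1) : ⟪stp c a, c⟫_ℝ = 0 := by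
  simp only [stp, inner_smul_left, inner_sub_left, hc]
  simp

lemma pp_pos (p : E) : 0 < ⟪p, p⟫_ℝ + 1 := by
  have : 0 ≤ ⟪p, p⟫_ℝ := real_inner_self_nonneg
  linarith

lemma sti_inner {c p : E} (hc : ⟪c, c⟫_ℝ = 1) (hp : ⟪p, c⟫_ℝ = 0) :
    ⟪sti c p, c⟫_ℝ = (⟪p, p⟫_ℝ - 1) / (⟪p, p⟫_ℝ + 1) := by
  simp only [sti, inner_smul_left, inner_add_left, hc, hp]
  simp
  ring

lemma sti_unit {c p : E} (hc : ⟪c, c⟫_ℝ = 1) (hp : ⟪p, c⟫_ℝ = 0) :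
    ⟪sti c p, sti c p⟫_ℝ = 1 := by
  have h := (pp_pos p).ne'
  have hp' : ⟪c, p⟫_ℝ = 0 := by rw [real_inner_comm]; exact hp
  simp only [sti, inner_smul_left, inner_smul_right, inner_add_left, inner_add_right, hc, hp, hp']
  simp only [conj_trivial]
  field_simp
  ring

lemma sti_ne {c p : E} (hc : ⟪c, c⟫_ℝ = 1) (hp : ⟪p, c⟫_ℝ = 0) : sti c p ≠ c := by
  intro h
  have h1 := sti_inner hc hp
  rw [h, hc, eq_div_iff (pp_pos p).ne'] at h1
  linarith

lemma stp_sti {c p : E} (hc : ⟪c, c⟫_ℝ = 1) (hp : ⟪p, c⟫_ℝ = 0) : stp c (sti c p) = p := by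
  have h := (pp_pos p).ne'
  have e : 1 - (⟪p, p⟫_ℝ - 1) / (⟪p, p⟫_ℝ + 1) = 2 / (⟪p, p⟫_ℝ + 1) := by
    field_simp; ring
  rw [stp, sti_inner hc hp, e, sti]
  match_scalars
  · field_simp
  · field_simp; ring

lemma sti_stp {c a : E} (hc : ⟪c, c⟫_ℝ = 1) (ha : ⟪a, a⟫_ℝ = 1) (h : a ≠ c) :
    sti c (stp c a) = a := by
  have h1 := one_sub_ne hc ha h
  have e : ⟪stp c a, stp c a⟫_ℝ = (1 + ⟪a, c⟫_ℝ) / (1 - ⟪a, c⟫_ℝ) := by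
    simp only [stp, inner_smul_left, inner_smul_right, inner_sub_left, inner_sub_right, hc, ha,
      real_inner_comm a c, conj_trivial]
    field_simp
    ring
  have e1 : ⟪stp c a, stp c a⟫_ℝ + 1 = 2 / (1 - ⟪a, c⟫_ℝ) := by rw [e]; field_simp; ring
  have e2 : ⟪stp c a, stp c a⟫_ℝ - 1 = 2 * ⟪a, c⟫_ℝ / (1 - ⟪a, c⟫_ℝ) := by
    rw [e]; field_simp; ring
  rw [sti, e1, e2, stp]
  match_scalars
  · field_simp
  · field_simp; ring

end stereo

abbrev E3 := EuclideanSpace ℝ (Fin 3)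

abbrev TT : Type := {x : E3 × E3 × E3 // ⟪x.1, x.1⟫_ℝ = 1 ∧ ⟪x.2.1, x.1⟫_ℝ = 0 ∧
  ⟪x.2.2, x.1⟫_ℝ = 0 ∧ x.2.1 ≠ x.2.2}

noncomputable def phi : OnePoint ℂ ≃ₜ Metric.sphere (0 : E3) 1 :=
  onePointEquivSphereOfFinrankEq (by simp [Complex.finrank_real_complex])

lemma sph (x : Metric.sphere (0 : E3) 1) : ⟪(x:E3), (x:E3)⟫_ℝ = 1 := by
  rw [real_inner_self_eq_norm_sq]
  simp

lemma sph' {x : E3} (h : ⟪x, x⟫_ℝ = 1) : x ∈ Metric.sphere (0 : E3) 1 := by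
  rw [real_inner_self_eq_norm_sq] at h
  rw [mem_sphere_zero_iff_norm]
  nlinarith [norm_nonneg x]

abbrev CC : Type :=
  {f : Fin 3 → OnePoint ℂ // ∀ i j : Fin 3, i ≠ j → f i ≠ f j}

lemma phi_ne (f : CC) {i j : Fin 3} (h : i ≠ j) : (phi (f.1 i) : E3) ≠ phi (f.1 j) := by
  intro e
  exact f.2 i j h (phi.injective (Subtype.ext e))

noncomputable def confHomeo : CC ≃ₜ TT where
  toFun f := ⟨(phi (f.1 2), stp (phi (f.1 2) : E3) (phi (f.1 0)),
      stp (phi (f.1 2) : E3) (phi (f.1 1))), sph _, stp_perp (sph _), stp_perp (sph _), by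
    intro h
    have h2 := congrArg (sti (phi (f.1 2) : E3)) h
    simp only at h2
    rw [sti_stp (sph _) (sph _) (phi_ne f (by decide)),
      sti_stp (sph _) (sph _) (phi_ne f (by decide))] at h2
    exact phi_ne f (by decide) h2⟩
  invFun x := ⟨![phi.symm ⟨sti x.1.1 x.1.2.1, sph' (sti_unit x.2.1 x.2.2.1)⟩,
      phi.symm ⟨sti x.1.1 x.1.2.2, sph' (sti_unit x.2.1 x.2.2.2.1)⟩,
      phi.symm ⟨x.1.1, sph' x.2.1⟩], by
    obtain ⟨⟨c, p, q⟩, hc, hp, hq, hpq⟩ := x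
    simp only at hc hp hq hpq
    have h1 := sti_ne hc hp
    have h2 := sti_ne hc hq
    have h3 : sti c p ≠ sti c q := by
      intro h
      have := congrArg (stp c) h
      rw [stp_sti hc hp, stp_sti hc hq] at this
      exact hpq this
    intro i j
    fin_cases i <;> fin_cases j <;> simp [h1, h2, h3, h1.symm, h2.symm, h3.symm]⟩
  left_inv f := by
    apply Subtype.ext
    funext i
    have h0 := sti_stp (sph (phi (f.1 2))) (sph (phi (f.1 0))) (phi_ne f (by decide))
    have h1 := sti_stp (sph (phi (f.1 2))) (sph (phi (f.1 1))) (phi_ne f (by decide))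
    fin_cases i <;> simp [h0, h1]
  right_inv x := by
    obtain ⟨⟨c, p, q⟩, hc, hp, hq, hpq⟩ := x
    simp only at hc hp hq hpq
    apply Subtype.ext
    simp [stp_sti hc hp, stp_sti hc hq]
  continuous_toFun := by
    have hc : ∀ i, Continuous fun f : CC => (phi (f.1 i) : E3) := fun i =>
      continuous_subtype_val.comp (phi.continuous.comp
        ((continuous_apply i).comp continuous_subtype_val))
    have hs : ∀ i : Fin 3, i ≠ 2 →
        Continuous fun f : CC => stp (phi (f.1 2) : E3) (phi (f.1 i)) := by
      intro i hi
      unfold stp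
      have ht := (hc i).inner (𝕜 := ℝ) (hc 2)
      exact ((continuous_const.sub ht).inv₀
        (fun f => one_sub_ne (sph _) (sph _) (phi_ne f hi))).smul
        ((hc i).sub (ht.smul (hc 2)))
    exact Continuous.subtype_mk ((hc 2).prodMk ((hs 0 (by decide)).prodMk (hs 1 (by decide)))) _
  continuous_invFun := by
    have hs : ∀ g : TT → E3, Continuous g → Continuous fun x : TT => sti x.1.1 (g x) := by
      intro g hg
      unfold sti
      have ht := hg.inner (𝕜 := ℝ) hg
      have h1 : Continuous fun x : TT => x.1.1 := continuous_fst.comp continuous_subtype_val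
      exact ((ht.add continuous_const).inv₀ (fun x => (pp_pos _).ne')).smul
        ((hg.const_smul (2:ℝ)).add ((ht.sub continuous_const).smul h1))
    apply Continuous.subtype_mk
    refine continuous_pi fun i => ?_
    fin_cases i
    · exact phi.symm.continuous.comp (Continuous.subtype_mk (hs _ (by fun_prop)) _)
    · exact phi.symm.continuous.comp (Continuous.subtype_mk (hs _ (by fun_prop)) _)
    · exact phi.symm.continuous.comp (Continuous.subtype_mk (by fun_prop) _)
lemma SO3_rows (A : SO3) :
    (A.1 0 0 * A.1 0 0 + A.1 0 1 * A.1 0 1 + A.1 0 2 * A.1 0 2 = 1) ∧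
    (A.1 1 0 * A.1 1 0 + A.1 1 1 * A.1 1 1 + A.1 1 2 * A.1 1 2 = 1) ∧
    (A.1 2 0 * A.1 2 0 + A.1 2 1 * A.1 2 1 + A.1 2 2 * A.1 2 2 = 1) ∧
    (A.1 0 0 * A.1 1 0 + A.1 0 1 * A.1 1 1 + A.1 0 2 * A.1 1 2 = 0) ∧
    (A.1 0 0 * A.1 2 0 + A.1 0 1 * A.1 2 1 + A.1 0 2 * A.1 2 2 = 0) ∧
    (A.1 1 0 * A.1 2 0 + A.1 1 1 * A.1 2 1 + A.1 1 2 * A.1 2 2 = 0) := by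
  have h := (Matrix.mem_orthogonalGroup_iff _ _).1 A.2.1
  have e := fun i j => congrFun (congrFun h i) j
  simp only [Matrix.mul_apply, Fin.sum_univ_three, Matrix.transpose_apply, Matrix.one_apply] at e
  exact ⟨by simpa using e 0 0, by simpa using e 1 1, by simpa using e 2 2, by simpa using e 0 1,
    by simpa using e 0 2, by simpa using e 1 2⟩

lemma SO3_cols (A : SO3) :
    (A.1 0 0 * A.1 0 0 + A.1 1 0 * A.1 1 0 + A.1 2 0 * A.1 2 0 = 1) ∧
    (A.1 0 1 * A.1 0 1 + A.1 1 1 * A.1 1 1 + A.1 2 1 * A.1 2 1 = 1) ∧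
    (A.1 0 2 * A.1 0 2 + A.1 1 2 * A.1 1 2 + A.1 2 2 * A.1 2 2 = 1) ∧
    (A.1 0 0 * A.1 0 1 + A.1 1 0 * A.1 1 1 + A.1 2 0 * A.1 2 1 = 0) ∧
    (A.1 0 0 * A.1 0 2 + A.1 1 0 * A.1 1 2 + A.1 2 0 * A.1 2 2 = 0) ∧
    (A.1 0 1 * A.1 0 2 + A.1 1 1 * A.1 1 2 + A.1 2 1 * A.1 2 2 = 0) := by
  have h := (Matrix.mem_orthogonalGroup_iff' _ _).1 A.2.1
  have e := fun i j => congrFun (congrFun h i) j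
  simp only [Matrix.mul_apply, Fin.sum_univ_three, Matrix.transpose_apply, Matrix.one_apply] at e
  exact ⟨by simpa using e 0 0, by simpa using e 1 1, by simpa using e 2 2, by simpa using e 0 1,
    by simpa using e 0 2, by simpa using e 1 2⟩

lemma SO3_cof (A : SO3) :
    (A.1 0 0 = A.1 1 1 * A.1 2 2 - A.1 1 2 * A.1 2 1) ∧
    (A.1 0 1 = A.1 1 2 * A.1 2 0 - A.1 1 0 * A.1 2 2) ∧
    (A.1 0 2 = A.1 1 0 * A.1 2 1 - A.1 1 1 * A.1 2 0) ∧
    (A.1 1 0 = A.1 2 1 * A.1 0 2 - A.1 2 2 * A.1 0 1) ∧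
    (A.1 1 1 = A.1 2 2 * A.1 0 0 - A.1 2 0 * A.1 0 2) ∧
    (A.1 1 2 = A.1 2 0 * A.1 0 1 - A.1 2 1 * A.1 0 0) ∧
    (A.1 2 0 = A.1 0 1 * A.1 1 2 - A.1 0 2 * A.1 1 1) ∧
    (A.1 2 1 = A.1 0 2 * A.1 1 0 - A.1 0 0 * A.1 1 2) ∧
    (A.1 2 2 = A.1 0 0 * A.1 1 1 - A.1 0 1 * A.1 1 0) := by
  have h := (Matrix.mem_orthogonalGroup_iff _ _).1 A.2.1
  have h2 : A.1.adjugate = A.1.transpose := by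
    calc A.1.adjugate = A.1.adjugate * (A.1 * A.1.transpose) := by rw [h, mul_one]
      _ = A.1.transpose := by rw [← mul_assoc, Matrix.adjugate_mul, A.2.2, one_smul, one_mul]
  have e := fun i j => congrFun (congrFun h2 i) j
  rw [Matrix.adjugate_fin_three] at e
  have e00 := e 0 0
  have e01 := e 0 1
  have e02 := e 0 2
  have e10 := e 1 0
  have e11 := e 1 1
  have e12 := e 1 2
  have e20 := e 2 0
  have e21 := e 2 1
  have e22 := e 2 2
  simp at e00 e01 e02 e10 e11 e12 e20 e21 e22
  refine ⟨?_, ?_, ?_, ?_, ?_, ?_, ?_, ?_, ?_⟩ <;> linarith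

lemma frame_mem (a b c d e f : ℝ) (h1 : a * a + b * b + c * c = 1) (h2 : d * d + e * e + f * f = 1)
    (h3 : a * d + b * e + c * f = 0) :
    (!![a, b, c; d, e, f; b * f - c * e, c * d - a * f, a * e - b * d] :
      Matrix (Fin 3) (Fin 3) ℝ) ∈ Matrix.orthogonalGroup (Fin 3) ℝ ∧
    (!![a, b, c; d, e, f; b * f - c * e, c * d - a * f, a * e - b * d] :
      Matrix (Fin 3) (Fin 3) ℝ).det = 1 := by
  have h4 : (b * f - c * e) * (b * f - c * e) + (c * d - a * f) * (c * d - a * f)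
      + (a * e - b * d) * (a * e - b * d) = 1 := by
    linear_combination (d * d + e * e + f * f) * h1 + h2 - (a * d + b * e + c * f) * h3
  constructor
  · rw [Matrix.mem_orthogonalGroup_iff]
    ext i j
    fin_cases i <;> fin_cases j <;>
      simp [Matrix.mul_apply, Fin.sum_univ_three] <;> linarith
  · rw [Matrix.det_fin_three]
    simp
    linarith

lemma rank_one (M : Fin 4 → Fin 4 → ℝ) (hM : ∀ i j k, M i i * M j k = M i j * M i k)
    (ht : M 0 0 + M 1 1 + M 2 2 + M 3 3 = 4) :
    ∃ q : Fin 4 → ℝ, ∀ j k, 4 * (q j * q k) = M j k := by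
  have : ∃ i, 0 < M i i := by
    by_contra! h
    linarith [h 0, h 1, h 2, h 3]
  obtain ⟨i, hi⟩ := this
  refine ⟨fun j => M i j / (2 * √(M i i)), fun j k => ?_⟩
  have hs := Real.sq_sqrt hi.le
  have hs0 : √(M i i) ≠ 0 := (Real.sqrt_pos.2 hi).ne'
  field_simp
  rw [hs]
  linarith [hM i j k]

def quatMat (w x y z : ℝ) : Matrix (Fin 3) (Fin 3) ℝ :=
  !![w * w + x * x - y * y - z * z, 2 * (x * y - w * z), 2 * (x * z + w * y);
     2 * (x * y + w * z), w * w - x * x + y * y - z * z, 2 * (y * z - w * x);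
     2 * (x * z - w * y), 2 * (y * z + w * x), w * w - x * x - y * y + z * z]

lemma quatMat_mem (w x y z : ℝ) (h : w * w + x * x + y * y + z * z = 1) :
    quatMat w x y z ∈ Matrix.orthogonalGroup (Fin 3) ℝ ∧ (quatMat w x y z).det = 1 := by
  have hh : (w * w + x * x + y * y + z * z) ^ 2 = 1 := by rw [h]; norm_num
  have h3 : (w * w + x * x + y * y + z * z) ^ 3 = 1 := by rw [h]; norm_num
  constructor
  · rw [Matrix.mem_orthogonalGroup_iff]
    ext i j
    fin_cases i <;> fin_cases j <;>
      simp [quatMat, Matrix.mul_apply, Fin.sum_univ_three] <;> linarith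
  · rw [Matrix.det_fin_three]
    simp [quatMat]
    linarith

lemma quat_surj (A : SO3) : ∃ q : Fin 4 → ℝ,
    q 0 * q 0 + q 1 * q 1 + q 2 * q 2 + q 3 * q 3 = 1 ∧
    quatMat (q 0) (q 1) (q 2) (q 3) = A.1 := by
  obtain ⟨r1, r2, r3, r4, r5, r6⟩ := SO3_rows A
  obtain ⟨c1, c2, c3, c4, c5, c6⟩ := SO3_cols A
  obtain ⟨k1, k2, k3, k4, k5, k6, k7, k8, k9⟩ := SO3_cof A
  obtain ⟨A, hA⟩ := A
  simp only at *
  clear hA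
  generalize hA00 : A 0 0 = a00 at *
  generalize hA01 : A 0 1 = a01 at *
  generalize hA02 : A 0 2 = a02 at *
  generalize hA10 : A 1 0 = a10 at *
  generalize hA11 : A 1 1 = a11 at *
  generalize hA12 : A 1 2 = a12 at *
  generalize hA20 : A 2 0 = a20 at *
  generalize hA21 : A 2 1 = a21 at *
  generalize hA22 : A 2 2 = a22 at *
  obtain ⟨q, hq⟩ := rank_one !![1 + a00 + a11 + a22, a21 - a12, a02 - a20, a10 - a01;
      a21 - a12, 1 + a00 - a11 - a22, a01 + a10, a02 + a20;
      a02 - a20, a01 + a10, 1 - a00 + a11 - a22, a12 + a21;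
      a10 - a01, a02 + a20, a12 + a21, 1 - a00 - a11 + a22]
    (by
      intro i j k
      fin_cases i <;> fin_cases j <;> fin_cases k <;> simp <;> linarith)
    (by simp; ring)
  have h00 := hq 0 0
  have h01 := hq 0 1
  have h02 := hq 0 2
  have h03 := hq 0 3
  have h11 := hq 1 1
  have h12 := hq 1 2
  have h13 := hq 1 3
  have h22 := hq 2 2
  have h23 := hq 2 3
  have h33 := hq 3 3
  simp at h00 h01 h02 h03 h11 h12 h13 h22 h23 h33
  refine ⟨q, by linarith, ?_⟩
  ext i j
  fin_cases i <;> fin_cases j <;> simp [quatMat, hA00, hA01, hA02, hA10, hA11, hA12, hA20, hA21, hA22] <;> linarith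

lemma quat_inj (p q : Fin 4 → ℝ) (hp : p 0 * p 0 + p 1 * p 1 + p 2 * p 2 + p 3 * p 3 = 1)
    (hq : q 0 * q 0 + q 1 * q 1 + q 2 * q 2 + q 3 * q 3 = 1)
    (h : quatMat (p 0) (p 1) (p 2) (p 3) = quatMat (q 0) (q 1) (q 2) (q 3)) :
    p = q ∨ p = -q := by
  have e := fun i j => congrFun (congrFun h i) j
  have e00 := e 0 0
  have e01 := e 0 1
  have e02 := e 0 2
  have e10 := e 1 0
  have e11 := e 1 1
  have e12 := e 1 2
  have e20 := e 2 0
  have e21 := e 2 1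
  have e22 := e 2 2
  simp [quatMat, -mul_eq_mul_left_iff] at e00 e01 e02 e10 e11 e12 e20 e21 e22
  have H : ∀ i j, p i * p j = q i * q j := by
    intro i j
    fin_cases i <;> fin_cases j <;> simp <;> linarith
  have : ∃ i, p i ≠ 0 := by
    by_contra! h0
    simp [h0] at hp
  obtain ⟨i, hi⟩ := this
  rcases mul_self_eq_mul_self_iff.1 (H i i) with h1 | h1
  · left
    funext j
    have := H i j
    rw [← h1] at this
    exact mul_left_cancel₀ hi this
  · right
    funext j
    have := H i j
    have h2 : q i = - p i := by linarith
    rw [h2] at this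
    apply mul_left_cancel₀ hi
    simp only [Pi.neg_apply]
    linarith

lemma sphere4 (x : EuclideanSpace ℝ (Fin 4)) : x ∈ ThreeSphere ↔
    x 0 * x 0 + x 1 * x 1 + x 2 * x 2 + x 3 * x 3 = 1 := by
  rw [mem_sphere_zero_iff_norm, ← sq_eq_sq₀ (norm_nonneg _) zero_le_one,
    EuclideanSpace.norm_sq_eq, Fin.sum_univ_four]
  simp [sq]

noncomputable def toSO3 (x : ThreeSphere) : SO3 :=
  ⟨quatMat (x.1 0) (x.1 1) (x.1 2) (x.1 3), quatMat_mem _ _ _ _ ((sphere4 _).1 x.2)⟩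

lemma toSO3_cont : Continuous toSO3 := by
  apply Continuous.subtype_mk
  refine continuous_matrix fun i j => ?_
  fin_cases i <;> fin_cases j <;> simp [quatMat] <;> fun_prop

lemma toSO3_iff (x y : ThreeSphere) : toSO3 x = toSO3 y ↔ (x = y ∨ x = -y) := by
  constructor
  · intro h
    rcases quat_inj x.1 y.1 ((sphere4 _).1 x.2) ((sphere4 _).1 y.2) (congrArg Subtype.val h) with
      h | h
    · left
      apply Subtype.ext
      ext i
      exact congrFun h i
    · right
      apply Subtype.ext
      ext i
      exact congrFun h i
  · rintro (rfl | rfl)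
    · rfl
    · apply Subtype.ext
      simp [toSO3, quatMat]

noncomputable def rpMap : RP3 → SO3 :=
  Quotient.lift toSO3 (fun x y h => (toSO3_iff x y).2 h)

lemma rpMap_cont : Continuous rpMap := toSO3_cont.quotient_lift _

lemma rpMap_bij : Function.Bijective rpMap := by
  constructor
  · intro x y
    induction x using Quotient.inductionOn with | _ x
    induction y using Quotient.inductionOn with | _ y
    intro h
    exact Quotient.sound ((toSO3_iff x y).1 h)
  · intro A
    obtain ⟨q, hq, h⟩ := quat_surj A
    refine ⟨Quotient.mk _ ⟨WithLp.toLp 2 q, (sphere4 _).2 hq⟩, ?_⟩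
    apply Subtype.ext
    exact h

noncomputable def rpHomeo : RP3 ≃ₜ SO3 :=
  Continuous.homeoOfEquivCompactToT2 (f := Equiv.ofBijective rpMap rpMap_bij) rpMap_cont

lemma inner3 (x y : E3) : ⟪x, y⟫_ℝ = x 0 * y 0 + x 1 * y 1 + x 2 * y 2 := by
  simp only [PiLp.inner_apply, Fin.sum_univ_three, RCLike.inner_apply, conj_trivial]
  ring

noncomputable def vv (x : TT) : E3 := ‖x.1.2.2 - x.1.2.1‖⁻¹ • (x.1.2.2 - x.1.2.1)

lemma nrm_pos (x : TT) : 0 < ‖x.1.2.2 - x.1.2.1‖ :=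
  norm_pos_iff.2 (sub_ne_zero.2 (Ne.symm x.2.2.2.2))

lemma vv_unit (x : TT) : ⟪vv x, vv x⟫_ℝ = 1 := by
  have h := (nrm_pos x).ne'
  rw [vv, real_inner_smul_left, real_inner_smul_right, real_inner_self_eq_norm_sq]
  field_simp

lemma vv_perp (x : TT) : ⟪x.1.1, vv x⟫_ℝ = 0 := by
  rw [vv, real_inner_smul_right, inner_sub_right, real_inner_comm, x.2.2.2.1,
    real_inner_comm, x.2.2.1]
  simp

lemma vv_cont : Continuous vv := by
  unfold vv
  have h : Continuous fun x : TT => x.1.2.2 - x.1.2.1 := by fun_prop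
  exact (h.norm.inv₀ (fun x => (nrm_pos x).ne')).smul h

lemma frame_cont {X : Type*} [TopologicalSpace X] (a b c d e f : X → ℝ) (ha : Continuous a)
    (hb : Continuous b) (hc : Continuous c) (hd : Continuous d) (he : Continuous e)
    (hf : Continuous f) : Continuous fun x => (!![a x, b x, c x; d x, e x, f x;
      b x * f x - c x * e x, c x * d x - a x * f x, a x * e x - b x * d x] :
      Matrix (Fin 3) (Fin 3) ℝ) := by
  refine continuous_matrix fun i j => ?_
  fin_cases i <;> fin_cases j <;> simp <;> fun_prop

lemma vv_coord (i : Fin 3) : Continuous fun x : TT => vv x i :=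
  (PiLp.continuous_apply 2 _ i).comp vv_cont

lemma cc_coord (i : Fin 3) : Continuous fun x : TT => x.1.1 i := by fun_prop

noncomputable def frameMap : C(TT, SO3) where
  toFun x := ⟨!![x.1.1 0, x.1.1 1, x.1.1 2; vv x 0, vv x 1, vv x 2;
      x.1.1 1 * vv x 2 - x.1.1 2 * vv x 1,
      x.1.1 2 * vv x 0 - x.1.1 0 * vv x 2,
      x.1.1 0 * vv x 1 - x.1.1 1 * vv x 0],
    frame_mem (x.1.1 0) (x.1.1 1) (x.1.1 2) (vv x 0) (vv x 1) (vv x 2)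
    ((inner3 _ _).symm.trans x.2.1) ((inner3 _ _).symm.trans (vv_unit x))
    ((inner3 _ _).symm.trans (vv_perp x))⟩
  continuous_toFun := Continuous.subtype_mk (frame_cont _ _ _ _ _ _ (cc_coord 0) (cc_coord 1)
    (cc_coord 2) (vv_coord 0) (vv_coord 1) (vv_coord 2)) _

noncomputable def row (A : SO3) (i : Fin 3) : E3 := WithLp.toLp 2 (A.1 i)

lemma row_cont (i : Fin 3) : Continuous fun A : SO3 => row A i := by
  unfold row
  have : Continuous fun A : SO3 => A.1 i := (continuous_apply i).comp continuous_subtype_val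
  exact (PiLp.continuous_toLp 2 _).comp this

lemma row_unit0 (A : SO3) : ⟪row A 0, row A 0⟫_ℝ = 1 := by
  rw [inner3]; exact (SO3_rows A).1

lemma row_unit1 (A : SO3) : ⟪row A 1, row A 1⟫_ℝ = 1 := by
  rw [inner3]; exact (SO3_rows A).2.1

lemma row_perp (A : SO3) : ⟪row A 1, row A 0⟫_ℝ = 0 := by
  rw [real_inner_comm, inner3]; exact (SO3_rows A).2.2.2.1

noncomputable def backMap : C(SO3, TT) where
  toFun A := ⟨(row A 0, 0, row A 1), row_unit0 A, inner_zero_left _, row_perp A, by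
    intro h
    have := row_unit1 A
    simp only at h
    rw [← h] at this
    simp at this⟩
  continuous_toFun :=
    Continuous.subtype_mk ((row_cont 0).prodMk (continuous_const.prodMk (row_cont 1))) _

lemma vv_back (A : SO3) : vv (backMap A) = row A 1 := by
  have h := row_unit1 A
  rw [real_inner_self_eq_norm_sq] at h
  have h1 : ‖row A 1‖ = 1 := by nlinarith [norm_nonneg (row A 1)]
  simp [vv, backMap, h1]

lemma frame_back (A : SO3) : frameMap (backMap A) = A := by
  apply Subtype.ext
  obtain ⟨-, -, -, -, -, -, k7, k8, k9⟩ := SO3_cof A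
  have e : (frameMap (backMap A)).1 = !![row A 0 0, row A 0 1, row A 0 2;
      vv (backMap A) 0, vv (backMap A) 1, vv (backMap A) 2;
      row A 0 1 * vv (backMap A) 2 - row A 0 2 * vv (backMap A) 1,
      row A 0 2 * vv (backMap A) 0 - row A 0 0 * vv (backMap A) 2,
      row A 0 0 * vv (backMap A) 1 - row A 0 1 * vv (backMap A) 0] := rfl
  rw [e, vv_back]
  ext i j
  fin_cases i <;> fin_cases j <;> simp [row] <;> linarith

noncomputable def htpyFun (s : ℝ) (x : TT) : E3 × E3 × E3 :=
  (x.1.1, s • x.1.2.1,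
    s • x.1.2.1 + (s + (1 - s) * ‖x.1.2.2 - x.1.2.1‖⁻¹) • (x.1.2.2 - x.1.2.1))

lemma htpy_mem (s : unitInterval) (x : TT) : ⟪(htpyFun s x).1, (htpyFun s x).1⟫_ℝ = 1 ∧
    ⟪(htpyFun s x).2.1, (htpyFun s x).1⟫_ℝ = 0 ∧
    ⟪(htpyFun s x).2.2, (htpyFun s x).1⟫_ℝ = 0 ∧ (htpyFun s x).2.1 ≠ (htpyFun s x).2.2 := by
  have hn := nrm_pos x
  refine ⟨x.2.1, ?_, ?_, ?_⟩
  · simp only [htpyFun, real_inner_smul_left, x.2.2.1, mul_zero]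
  · simp only [htpyFun, real_inner_smul_left, inner_add_left, inner_sub_left, x.2.2.1,
      x.2.2.2.1, mul_zero, sub_zero, add_zero]
  · intro h
    simp only [htpyFun, left_eq_add, smul_eq_zero] at h
    rcases h with h | h
    · have h0 := s.2.1
      have h1 := s.2.2
      have hi := inv_pos.2 hn
      rcases eq_or_lt_of_le h0 with h2 | h2
      · rw [← h2] at h
        linarith
      · have := mul_nonneg (sub_nonneg.2 h1) hi.le
        linarith
    · rw [h] at hn
      simp at hn

noncomputable def htpy : ContinuousMap.Homotopy (backMap.comp frameMap) (ContinuousMap.id TT) where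
  toFun y := ⟨htpyFun y.1 y.2, htpy_mem y.1 y.2⟩
  continuous_toFun := by
    apply Continuous.subtype_mk
    unfold htpyFun
    have hs : Continuous fun y : unitInterval × TT => (y.1 : ℝ) := by fun_prop
    have h1 : Continuous fun y : unitInterval × TT => y.2.1.1 := by fun_prop
    have h2 : Continuous fun y : unitInterval × TT => y.2.1.2.1 := by fun_prop
    have h3 : Continuous fun y : unitInterval × TT => y.2.1.2.2 - y.2.1.2.1 := by fun_prop
    have h4 : Continuous fun y : unitInterval × TT => ‖y.2.1.2.2 - y.2.1.2.1‖⁻¹ :=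
      h3.norm.inv₀ (fun y => (nrm_pos y.2).ne')
    fun_prop
  map_zero_left x := by
    apply Subtype.ext
    have h0 : row (frameMap x) 0 = x.1.1 := by
      ext i; fin_cases i <;> simp [row, frameMap]
    have h1 : row (frameMap x) 1 = vv x := by
      ext i; fin_cases i <;> simp [row, frameMap]
    have e : ((backMap.comp frameMap) x).1 = (row (frameMap x) 0, 0, row (frameMap x) 1) := rfl
    rw [e, h0, h1]
    simp [htpyFun, vv]
  map_one_left x := by
    apply Subtype.ext
    simp [htpyFun]

noncomputable def ttEquiv : ContinuousMap.HomotopyEquiv TT SO3 where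
  toFun := frameMap
  invFun := backMap
  left_inv := ⟨htpy⟩
  right_inv := by
    have : frameMap.comp backMap = ContinuousMap.id SO3 := by
      ext1 A
      exact frame_back A
    rw [this]

theorem stmt_11 :
    Nonempty (ContinuousMap.HomotopyEquiv ConfThreeP1 SO3) ∧
    Nonempty (ContinuousMap.HomotopyEquiv ConfThreeP1 RP3) :=
  ⟨⟨confHomeo.toHomotopyEquiv.trans ttEquiv⟩,
    ⟨(confHomeo.toHomotopyEquiv.trans ttEquiv).trans rpHomeo.symm.toHomotopyEquiv⟩⟩
end

section
/- The configuration space C₃(ℙ¹) of three ordered pairwise-distinct points on the Riemann sphere ℙ¹ = ℂ ∪ {∞} is homeomorphic to the projective linear group PGL₂(ℂ), i.e. the quotient of the topological group GL₂(ℂ) by its center, equipped with the quotient topology. (The homeomorphism sends a triple (p₁,p₂,p₃) to the unique homography mapping (p₁,p₂,p₃) to (0,1,∞).) -/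
/-- The projective linear group `PGL₂(ℂ)`: the quotient of the topological
group `GL₂(ℂ)` by its center, with the quotient topology. -/
abbrev PGL2C : Type :=
  GL (Fin 2) ℂ ⧸ Subgroup.center (GL (Fin 2) ℂ)

open scoped OnePoint Topology
open Filter

noncomputable def hq (a b : ℂ) : OnePoint ℂ := if b = 0 then ∞ else ((a / b : ℂ) : OnePoint ℂ)

noncomputable def hJ (z : ℂ) : OnePoint ℂ := if z = 0 then ∞ else ((z⁻¹ : ℂ) : OnePoint ℂ)

lemma hJ_cont : ContinuousAt hJ 0 := by
  rw [continuousAt_iff_punctured_nhds]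
  have h : Tendsto (fun z : ℂ => ((z⁻¹ : ℂ) : OnePoint ℂ)) (𝓝[≠] 0) (𝓝 ∞) := by
    refine OnePoint.tendsto_coe_infty.comp ?_
    rw [coclosedCompact_eq_cocompact, ← Metric.cobounded_eq_cocompact]
    exact tendsto_inv₀_nhdsNE_zero
  have : hJ 0 = ∞ := by simp [hJ]
  rw [this]
  refine h.congr' ?_
  filter_upwards [self_mem_nhdsWithin] with z hz
  have hz : z ≠ 0 := hz
  simp [hJ, hz]

lemma hq_cont (a b : ℂ) (h : a ≠ 0 ∨ b ≠ 0) :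
    ContinuousAt (fun p : ℂ × ℂ => hq p.1 p.2) (a, b) := by
  by_cases hb : b = 0
  · subst hb
    have ha : a ≠ 0 := by simpa using h
    have h1 : ContinuousAt (fun p : ℂ × ℂ => hJ (p.2 / p.1)) (a, 0) := by
      have h2 : ContinuousAt (fun p : ℂ × ℂ => p.2 / p.1) (a, 0) :=
        continuousAt_snd.div continuousAt_fst ha
      refine ContinuousAt.comp (g := hJ) ?_ h2
      simpa using hJ_cont
    refine h1.congr ?_
    have : ∀ᶠ p : ℂ × ℂ in 𝓝 (a, 0), p.1 ≠ 0 := continuousAt_fst.eventually_ne ha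
    filter_upwards [this] with p hp
    simp [hJ, hq, hp]
  · have h1 : ContinuousAt (fun p : ℂ × ℂ => ((p.1 / p.2 : ℂ) : OnePoint ℂ)) (a, b) :=
      OnePoint.continuous_coe.continuousAt.comp (continuousAt_fst.div continuousAt_snd hb)
    refine h1.congr ?_
    have : ∀ᶠ p : ℂ × ℂ in 𝓝 (a, b), p.2 ≠ 0 := continuousAt_snd.eventually_ne hb
    filter_upwards [this] with p hp
    simp [hq, hp]

lemma smul_inf_hq (g : GL (Fin 2) ℂ) : g • (∞ : OnePoint ℂ) = hq (g 0 0) (g 1 0) := by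
  rw [OnePoint.smul_infty_eq_ite]; rfl

lemma smul_coe_hq (g : GL (Fin 2) ℂ) (k : ℂ) :
    g • (k : OnePoint ℂ) = hq (g 0 0 * k + g 0 1) (g 1 0 * k + g 1 1) := by
  rw [OnePoint.smul_some_eq_ite]; rfl

lemma hq_smul (c a b : ℂ) (hc : c ≠ 0) : hq (c * a) (c * b) = hq a b := by
  simp [hq, hc, mul_div_mul_left]

lemma gdet (g : GL (Fin 2) ℂ) : g 0 0 * g 1 1 - g 0 1 * g 1 0 ≠ 0 := by
  have := g.det_ne_zero
  rwa [Matrix.det_fin_two] at this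

noncomputable def hinv (p : OnePoint ℂ) : ℂ := p.elim 0 (fun z => z⁻¹)

lemma hinv_cont : ContinuousAt hinv ∞ := by
  rw [OnePoint.continuousAt_infty', coclosedCompact_eq_cocompact, ← Metric.cobounded_eq_cocompact]
  exact tendsto_inv₀_cobounded

lemma cont_entry (i j : Fin 2) : Continuous (fun g : GL (Fin 2) ℂ => g i j) :=
  Units.continuous_val.matrix_elem i j

instance contSMulP1 : ContinuousSMul (GL (Fin 2) ℂ) (OnePoint ℂ) := by
  constructor
  rw [continuous_iff_continuousAt]
  rintro ⟨g, p⟩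
  have he : ∀ i j, ContinuousAt (fun x : GL (Fin 2) ℂ × OnePoint ℂ => x.1 i j) (g, p) := fun i j =>
    ((cont_entry i j).comp continuous_fst).continuousAt
  have hd := gdet g
  induction p using OnePoint.rec with
  | infty =>
    have hi : ContinuousAt (fun x : GL (Fin 2) ℂ × OnePoint ℂ => hinv x.2) (g, ∞) :=
      ContinuousAt.comp (g := hinv) hinv_cont continuousAt_snd
    have h1 : ContinuousAt (fun x : GL (Fin 2) ℂ × OnePoint ℂ =>
        (x.1 0 0 + x.1 0 1 * hinv x.2, x.1 1 0 + x.1 1 1 * hinv x.2)) (g, ∞) :=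
      ((he 0 0).add ((he 0 1).mul hi)).prodMk ((he 1 0).add ((he 1 1).mul hi))
    have h2 : ContinuousAt (fun x : GL (Fin 2) ℂ × OnePoint ℂ =>
        hq (x.1 0 0 + x.1 0 1 * hinv x.2) (x.1 1 0 + x.1 1 1 * hinv x.2)) (g, ∞) := by
      refine ContinuousAt.comp (g := fun p : ℂ × ℂ => hq p.1 p.2) (x := (g, ∞)) (f := fun x : GL (Fin 2) ℂ × OnePoint ℂ =>
        (x.1 0 0 + x.1 0 1 * hinv x.2, x.1 1 0 + x.1 1 1 * hinv x.2)) (hq_cont _ _ ?_) h1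
      simp only [hinv, OnePoint.elim_infty, mul_zero, add_zero]
      by_contra! hh
      simp [hh] at hd
    refine h2.congr ?_
    have : ∀ᶠ x : GL (Fin 2) ℂ × OnePoint ℂ in 𝓝 (g, ∞), x.2 ≠ ((0 : ℂ) : OnePoint ℂ) :=
      continuousAt_snd.eventually_ne (OnePoint.infty_ne_coe 0)
    filter_upwards [this]
    rintro ⟨g', p'⟩ hp
    induction p' using OnePoint.rec with
    | infty => simp [smul_inf_hq, hinv]
    | coe k =>
      have hk : k ≠ 0 := by simpa using hp
      simp only [smul_coe_hq, hinv, OnePoint.elim_some]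
      rw [← hq_smul k _ _ hk]
      congr 1 <;> field_simp
  | coe k =>
    have ho : Topology.IsOpenEmbedding
        (Prod.map id (↑) : GL (Fin 2) ℂ × ℂ → GL (Fin 2) ℂ × OnePoint ℂ) :=
      Topology.IsOpenEmbedding.id.prodMap OnePoint.isOpenEmbedding_coe
    have h0 : (g, (k : OnePoint ℂ)) = Prod.map id (↑) (g, k) := rfl
    rw [h0, ← ho.continuousAt_iff]
    have : ((fun x : GL (Fin 2) ℂ × OnePoint ℂ => x.1 • x.2) ∘ Prod.map id (↑)) =
      fun x : GL (Fin 2) ℂ × ℂ => hq (x.1 0 0 * x.2 + x.1 0 1) (x.1 1 0 * x.2 + x.1 1 1) := by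
      funext x
      exact smul_coe_hq _ _
    rw [this]
    have he : ∀ i j, ContinuousAt (fun x : GL (Fin 2) ℂ × ℂ => x.1 i j) (g, k) := fun i j =>
      ((cont_entry i j).comp continuous_fst).continuousAt
    have h1 : ContinuousAt (fun x : GL (Fin 2) ℂ × ℂ =>
        (x.1 0 0 * x.2 + x.1 0 1, x.1 1 0 * x.2 + x.1 1 1)) (g, k) :=
      (((he 0 0).mul continuousAt_snd).add (he 0 1)).prodMk
        (((he 1 0).mul continuousAt_snd).add (he 1 1))
    refine ContinuousAt.comp (g := fun p : ℂ × ℂ => hq p.1 p.2) (x := (g, k)) (f := fun x : GL (Fin 2) ℂ × ℂ =>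
        (x.1 0 0 * x.2 + x.1 0 1, x.1 1 0 * x.2 + x.1 1 1)) (hq_cont _ _ ?_) h1
    by_contra! hh
    obtain ⟨ha, hb⟩ := hh
    apply hd
    linear_combination (g 0 0) * hb - (g 1 0) * ha

noncomputable instance confAction : MulAction (GL (Fin 2) ℂ) ConfThreeP1 where
  smul g f := ⟨fun i => g • f.1 i, fun i j h e => f.2 i j h (smul_left_cancel g e)⟩
  one_smul f := Subtype.ext (funext fun i => one_smul _ (f.1 i))
  mul_smul g h f := Subtype.ext (funext fun i => mul_smul g h (f.1 i))

lemma conf_smul_val (g : GL (Fin 2) ℂ) (f : ConfThreeP1) (i : Fin 3) :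
    (g • f).1 i = g • f.1 i := rfl

instance confCont : ContinuousSMul (GL (Fin 2) ℂ) ConfThreeP1 := by
  constructor
  refine Continuous.subtype_mk (continuous_pi fun i => ?_) _
  exact continuous_fst.smul ((continuous_apply i).comp (continuous_subtype_val.comp continuous_snd))

def basePt : ConfThreeP1 := ⟨![∞, ((0 : ℂ) : OnePoint ℂ), ((1 : ℂ) : OnePoint ℂ)], by
  intro i j h
  fin_cases i <;> fin_cases j <;> simp at h ⊢⟩

noncomputable def lx (p : OnePoint ℂ) : ℂ := p.elim 1 (fun z => z)
noncomputable def ly (p : OnePoint ℂ) : ℂ := p.elim 0 (fun _ => 1)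

lemma hq_lift (p : OnePoint ℂ) : hq (lx p) (ly p) = p := by
  induction p using OnePoint.rec <;> simp [hq, lx, ly]

lemma det_lift (p q : OnePoint ℂ) (h : p ≠ q) : lx p * ly q - lx q * ly p ≠ 0 := by
  induction p using OnePoint.rec <;> induction q using OnePoint.rec <;>
    simp_all [lx, ly, sub_eq_zero]

lemma trans_base (f : ConfThreeP1) : ∃ g : GL (Fin 2) ℂ, g • basePt = f := by
  have h01 := det_lift _ _ (f.2 0 1 (by decide))
  have h21 := det_lift _ _ (f.2 2 1 (by decide))
  have h02 := det_lift _ _ (f.2 0 2 (by decide))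
  have e0 := hq_lift (f.1 0)
  have e1 := hq_lift (f.1 1)
  have e2 := hq_lift (f.1 2)
  generalize lx (f.1 0) = a at *
  generalize ly (f.1 0) = a' at *
  generalize lx (f.1 1) = b at *
  generalize ly (f.1 1) = b' at *
  generalize lx (f.1 2) = c at *
  generalize ly (f.1 2) = c' at *
  let M : Matrix (Fin 2) (Fin 2) ℂ :=
    !![(c * b' - b * c') * a, (a * c' - c * a') * b; (c * b' - b * c') * a', (a * c' - c * a') * b']
  have hM : M.det ≠ 0 := by
    rw [Matrix.det_fin_two_of]
    have : (c * b' - b * c') * a * ((a * c' - c * a') * b') -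
      (a * c' - c * a') * b * ((c * b' - b * c') * a') =
      (c * b' - b * c') * (a * c' - c * a') * (a * b' - b * a') := by ring
    rw [this]
    exact mul_ne_zero (mul_ne_zero h21 h02) h01
  refine ⟨Matrix.GeneralLinearGroup.mkOfDetNeZero M hM, ?_⟩
  refine Subtype.ext (funext fun i => ?_)
  rw [conf_smul_val]
  fin_cases i
  · change _ • (∞ : OnePoint ℂ) = f.1 0
    rw [smul_inf_hq, ← e0]
    exact hq_smul _ _ _ h21
  · change _ • ((0 : ℂ) : OnePoint ℂ) = f.1 1
    rw [smul_coe_hq, ← e1, ← hq_smul _ b b' h02]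
    simp [Matrix.GeneralLinearGroup.mkOfDetNeZero, M]
  · change _ • ((1 : ℂ) : OnePoint ℂ) = f.1 2
    rw [smul_coe_hq, ← e2, ← hq_smul _ c c' h01]
    simp [Matrix.GeneralLinearGroup.mkOfDetNeZero, M]
    congr 1 <;> ring

instance : MulAction.IsPretransitive (GL (Fin 2) ℂ) ConfThreeP1 :=
  ⟨fun x y => by
    obtain ⟨g, rfl⟩ := trans_base x
    obtain ⟨h, rfl⟩ := trans_base y
    exact ⟨h * g⁻¹, by rw [mul_smul, inv_smul_smul]⟩⟩

lemma stab_base (g : GL (Fin 2) ℂ) :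
    g • basePt = basePt ↔ g ∈ Subgroup.center (GL (Fin 2) ℂ) := by
  rw [Matrix.GeneralLinearGroup.mem_center_iff_val_mem_range_scalar]
  have hd := gdet g
  constructor
  · intro h
    have h0 : g • (∞ : OnePoint ℂ) = ∞ := congrFun (congrArg Subtype.val h) 0
    have h1 : g • ((0 : ℂ) : OnePoint ℂ) = (0 : ℂ) := congrFun (congrArg Subtype.val h) 1
    have h2 : g • ((1 : ℂ) : OnePoint ℂ) = (1 : ℂ) := congrFun (congrArg Subtype.val h) 2
    rw [OnePoint.smul_infty_eq_self_iff] at h0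
    have hg : g 1 1 ≠ 0 := by
      intro hh
      simp [h0, hh] at hd
    rw [smul_coe_hq] at h1 h2
    simp only [hq, h0, mul_zero, zero_add, hg, if_false, zero_mul, OnePoint.coe_eq_coe,
      div_eq_zero_iff, or_false] at h1 h2
    rw [h1, div_eq_one_iff_eq hg] at h2
    refine ⟨g 1 1, ?_⟩
    ext i j
    fin_cases i <;> fin_cases j <;> simp_all
  · rintro ⟨a, ha⟩
    have e00 : g 0 0 = a := by rw [← ha]; simp
    have e11 : g 1 1 = a := by rw [← ha]; simp
    have e01 : g 0 1 = 0 := by rw [← ha]; simp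
    have e10 : g 1 0 = 0 := by rw [← ha]; simp
    have hne : a ≠ 0 := by
      rintro rfl
      simp [e00, e01] at hd
    refine Subtype.ext (funext fun i => ?_)
    rw [conf_smul_val]
    generalize basePt.1 i = p
    induction p using OnePoint.rec with
    | infty => simp [smul_inf_hq, e10, hq]
    | coe k => simp [smul_coe_hq, e00, e01, e10, e11, hq, hne]

instance : SigmaCompactSpace (Matrix (Fin 2) (Fin 2) ℂ) :=
  inferInstanceAs (SigmaCompactSpace (Fin 2 → Fin 2 → ℂ))

instance glSigma : SigmaCompactSpace (GL (Fin 2) ℂ) := by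
  have : SigmaCompactSpace (Matrix (Fin 2) (Fin 2) ℂ)ᵐᵒᵖ :=
    MulOpposite.opHomeomorph.symm.isClosedEmbedding.sigmaCompactSpace
  have h : Topology.IsClosedEmbedding (Units.embedProduct (Matrix (Fin 2) (Fin 2) ℂ)) := by
    exact Units.isClosedEmbedding_embedProduct
  exact h.sigmaCompactSpace

instance confLC : LocallyCompactSpace ConfThreeP1 := by
  have : IsOpen {f : Fin 3 → RiemannSphere | ∀ i j : Fin 3, i ≠ j → f i ≠ f j} := by
    simp only [Set.ofPred_forall]
    refine isOpen_iInter_of_finite fun i => isOpen_iInter_of_finite fun j =>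
      isOpen_iInter_of_finite fun _ => ?_
    exact isOpen_ne_fun (continuous_apply i) (continuous_apply j)
  exact this.locallyCompactSpace

/-- The configuration space `C₃(ℙ¹)` of three ordered pairwise-distinct points
of the Riemann sphere is homeomorphic to `PGL₂(ℂ)` (the homeomorphism sends a
triple `(p₁,p₂,p₃)` to the unique homography mapping it to `(0,1,∞)`). -/
theorem stmt_12 : Nonempty (ConfThreeP1 ≃ₜ PGL2C) := by
  have hc : Continuous (fun g : GL (Fin 2) ℂ => g • basePt) :=
    continuous_smul.comp (continuous_id.prodMk continuous_const)
  have ho : IsOpenMap (fun g : GL (Fin 2) ℂ => g • basePt) := isOpenMap_smul_of_sigmaCompact _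
  have key : ∀ g h : GL (Fin 2) ℂ,
      g • basePt = h • basePt ↔ (g : PGL2C) = (h : PGL2C) := by
    intro g h
    rw [QuotientGroup.eq, ← stab_base, mul_smul, inv_smul_eq_iff, eq_comm]
  let F : PGL2C → ConfThreeP1 := Quotient.lift (fun g : GL (Fin 2) ℂ => g • basePt)
    (fun g h e => (key g h).2 (Quotient.sound e))
  have hF : ∀ g : GL (Fin 2) ℂ, F (g : PGL2C) = g • basePt := fun g => rfl
  have hFc : Continuous F := hc.quotient_lift _
  have hFo : IsOpenMap F := by
    intro U hU
    have : F '' U = (fun g : GL (Fin 2) ℂ => g • basePt) ''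
        ((fun g : GL (Fin 2) ℂ => (g : PGL2C)) ⁻¹' U) := by
      ext y
      constructor
      · rintro ⟨x, hx, rfl⟩
        obtain ⟨g, rfl⟩ := QuotientGroup.mk_surjective x
        exact ⟨g, hx, rfl⟩
      · rintro ⟨g, hg, rfl⟩
        exact ⟨_, hg, rfl⟩
    rw [this]
    exact ho _ (hU.preimage continuous_quot_mk)
  have hb : Function.Bijective F := by
    constructor
    · intro x y hxy
      obtain ⟨g, rfl⟩ := QuotientGroup.mk_surjective x
      obtain ⟨h, rfl⟩ := QuotientGroup.mk_surjective y
      exact (key g h).1 hxy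
    · intro f
      obtain ⟨g, hg⟩ := trans_base f
      exact ⟨(g : PGL2C), hg⟩
  exact ⟨((Equiv.ofBijective F hb).toHomeomorphOfContinuousOpen hFc hFo).symm⟩
end

section
/- For every n ≥ 3 there is a homeomorphism C_n(ℙ¹) ≅ C₃(ℙ¹) × C_{n−3}(ℂ ∖ {0,1}), where ℙ¹ = ℂ ∪ {∞} is the Riemann sphere and C₀(X) is a one-point space. (The homeomorphism sends (p₁,…,pₙ) to ((p₁,p₂,p₃), (h(p₄),…,h(pₙ))) where h is the unique homography mapping (p₁,p₂,p₃) to (0,1,∞).) -/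
/-- The ordered configuration space of `n` points of a topological space `X`
(a one-point space when `n = 0`). -/
abbrev ConfSpace (n : ℕ) (X : Type*) [TopologicalSpace X] : Type _ :=
  {f : Fin n → X // ∀ i j : Fin n, i ≠ j → f i ≠ f j}

namespace Conf13

open Filter Topology OnePoint

noncomputable section

def br (u v : ℂ × ℂ) : ℂ := u.1 * v.2 - u.2 * v.1

def L (p : OnePoint ℂ) : ℂ × ℂ := p.elim (1, 0) (fun z => (z, 1))

open Classical in
def P (v : ℂ × ℂ) : OnePoint ℂ := if v.2 = 0 then ∞ else ((v.1 / v.2 : ℂ) : OnePoint ℂ)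

def cr (a b c p : ℂ × ℂ) : ℂ := br p a * br b c / (br p c * br b a)

def iv (a b c : ℂ × ℂ) (z : ℂ) : ℂ × ℂ := br b c • a + (z * br a b) • c

def CR (a b c p : OnePoint ℂ) : ℂ := cr (L a) (L b) (L c) (L p)

def IN (a b c : OnePoint ℂ) (z : ℂ) : OnePoint ℂ := P (iv (L a) (L b) (L c) z)

lemma br_L (p q : OnePoint ℂ) : br (L p) (L q) = 0 ↔ p = q := by
  induction p using OnePoint.rec <;> induction q using OnePoint.rec <;>
    simp [br, L, sub_eq_zero]

lemma P_L (p : OnePoint ℂ) : P (L p) = p := by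
  induction p using OnePoint.rec <;> simp [P, L]

lemma P_smul (k : ℂ) (hk : k ≠ 0) (v : ℂ × ℂ) : P (k • v) = P v := by
  by_cases h : v.2 = 0
  · simp [P, h]
  · simp [P, h, hk, mul_div_mul_left]

lemma L_P (v : ℂ × ℂ) (hv : v ≠ 0) : ∃ k : ℂ, k ≠ 0 ∧ L (P v) = k • v := by
  obtain ⟨x, y⟩ := v
  by_cases h : y = 0
  · subst h
    have hx : x ≠ 0 := by rintro rfl; exact hv rfl
    exact ⟨x⁻¹, inv_ne_zero hx, by simp [P, L, hx]⟩
  · exact ⟨y⁻¹, inv_ne_zero h, by simp [P, L, h, div_eq_inv_mul]⟩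

lemma br_smul_left (k : ℂ) (u v) : br (k • u) v = k * br u v := by simp [br]; ring
lemma br_smul_right (k : ℂ) (u v) : br u (k • v) = k * br u v := by simp [br]; ring
lemma br_zero_left (v) : br 0 v = 0 := by simp [br]

lemma br_iv_a (a b c z) : br (iv a b c z) a = z * br a b * br c a := by
  simp [br, iv]; ring
lemma br_iv_b (a b c z) : br (iv a b c z) b = (1 - z) * (br a b * br b c) := by
  simp [br, iv]; ring
lemma br_iv_c (a b c z) : br (iv a b c z) c = br b c * br a c := by
  simp [br, iv]; ring
lemma br_swap (a b) : br a b = - br b a := by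
  simp [br]; ring

section
variable {a b c : OnePoint ℂ} (hab : a ≠ b) (hac : a ≠ c) (hbc : b ≠ c)
include hab hac hbc

lemma iv_ne (z : ℂ) : iv (L a) (L b) (L c) z ≠ 0 := by
  intro h
  have := br_iv_c (L a) (L b) (L c) z
  rw [h, br_zero_left] at this
  exact mul_ne_zero ((br_L b c).not.2 hbc) ((br_L a c).not.2 hac) this.symm

lemma L_IN (z : ℂ) : ∃ k : ℂ, k ≠ 0 ∧ L (IN a b c z) = k • iv (L a) (L b) (L c) z :=
  L_P _ (iv_ne hab hac hbc z)

lemma IN_ne_a (z : ℂ) (hz : z ≠ 0) : IN a b c z ≠ a := by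
  obtain ⟨k, hk, h⟩ := L_IN hab hac hbc z
  rw [Ne, ← br_L, h, br_smul_left, br_iv_a]
  exact mul_ne_zero hk (mul_ne_zero (mul_ne_zero hz ((br_L _ _).not.2 hab))
    ((br_L _ _).not.2 hac.symm))

lemma IN_ne_b (z : ℂ) (hz : z ≠ 1) : IN a b c z ≠ b := by
  obtain ⟨k, hk, h⟩ := L_IN hab hac hbc z
  rw [Ne, ← br_L, h, br_smul_left, br_iv_b]
  exact mul_ne_zero hk (mul_ne_zero (sub_ne_zero.2 hz.symm) (mul_ne_zero ((br_L _ _).not.2 hab)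
    ((br_L _ _).not.2 hbc)))

lemma IN_ne_c (z : ℂ) : IN a b c z ≠ c := by
  obtain ⟨k, hk, h⟩ := L_IN hab hac hbc z
  rw [Ne, ← br_L, h, br_smul_left, br_iv_c]
  exact mul_ne_zero hk (mul_ne_zero ((br_L _ _).not.2 hbc) ((br_L _ _).not.2 hac))

lemma CR_IN (z : ℂ) : CR a b c (IN a b c z) = z := by
  obtain ⟨k, hk, h⟩ := L_IN hab hac hbc z
  have h1 := (br_L _ _).not.2 hab
  have h2 := (br_L _ _).not.2 hac
  have h3 := (br_L _ _).not.2 hbc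
  rw [CR, h, cr, br_smul_left, br_smul_left, br_iv_a, br_iv_c, br_swap (L c) (L a),
    br_swap (L b) (L a)]
  field_simp

lemma IN_CR (p : OnePoint ℂ) (hp : p ≠ c) : IN a b c (CR a b c p) = p := by
  have h1 := (br_L _ _).not.2 hab
  have h2 := (br_L _ _).not.2 hac
  have h3 := (br_L _ _).not.2 hbc
  have h4 := (br_L _ _).not.2 hp
  have key : iv (L a) (L b) (L c) (CR a b c p)
      = (br (L b) (L c) * br (L a) (L c) / br (L p) (L c)) • L p := by
    have e : CR a b c p * br (L a) (L b)
        = - (br (L p) (L a) * br (L b) (L c) / br (L p) (L c)) := by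
      rw [CR, cr, br_swap (L b) (L a)]; field_simp
    rw [iv, e]
    ext
    · simp only [Prod.fst_add, Prod.smul_fst, smul_eq_mul]
      field_simp
      simp only [br]; ring
    · simp only [Prod.snd_add, Prod.smul_snd, smul_eq_mul]
      field_simp
      simp only [br]; ring
  rw [IN, key, P_smul _ (div_ne_zero (mul_ne_zero h3 h2) h4), P_L]

lemma CR_ne_zero (p : OnePoint ℂ) (ha : p ≠ a) (hc : p ≠ c) : CR a b c p ≠ 0 :=
  div_ne_zero (mul_ne_zero ((br_L _ _).not.2 ha) ((br_L _ _).not.2 hbc))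
    (mul_ne_zero ((br_L _ _).not.2 hc) ((br_L _ _).not.2 hab.symm))

lemma CR_ne_one (p : OnePoint ℂ) (hb : p ≠ b) (hc : p ≠ c) : CR a b c p ≠ 1 := by
  intro h
  rw [CR, cr, div_eq_one_iff_eq (mul_ne_zero ((br_L _ _).not.2 hc) ((br_L _ _).not.2 hab.symm))] at h
  refine mul_ne_zero ((br_L _ _).not.2 hb) ((br_L _ _).not.2 hac) ?_
  simp only [br] at h ⊢
  linear_combination h

end

lemma exists_section (p₀ : OnePoint ℂ) : ∃ (s : OnePoint ℂ → ℂ × ℂ) (k : OnePoint ℂ → ℂ),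
    ContinuousAt s p₀ ∧ ∀ p, k p ≠ 0 ∧ s p = k p • L p := by
  classical
  induction p₀ using OnePoint.rec with
  | coe z =>
    refine ⟨L, fun _ => 1, ?_, by simp⟩
    rw [OnePoint.continuousAt_coe]
    change ContinuousAt (fun z : ℂ => (z, (1 : ℂ))) z
    fun_prop
  | infty =>
    let k : OnePoint ℂ → ℂ := fun p => p.elim 1 (fun z => if z = 0 then 1 else z⁻¹)
    refine ⟨fun p => k p • L p, k, ?_, ?_⟩
    · rw [OnePoint.continuousAt_infty']
      have h1 : Tendsto (fun z : ℂ => ((1 : ℂ), z⁻¹)) (coclosedCompact ℂ) (𝓝 (1, 0)) := by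
        refine tendsto_const_nhds.prodMk_nhds ?_
        rw [coclosedCompact_eq_cocompact, ← Metric.cobounded_eq_cocompact]
        exact tendsto_inv₀_cobounded
      have h2 : (fun z : ℂ => ((1 : ℂ), z⁻¹)) =ᶠ[coclosedCompact ℂ]
          ((fun p => k p • L p) ∘ ((↑) : ℂ → OnePoint ℂ)) := by
        have : ({0}ᶜ : Set ℂ) ∈ coclosedCompact ℂ := by
          rw [coclosedCompact_eq_cocompact]
          exact isCompact_singleton.compl_mem_cocompact
        filter_upwards [this] with z hz
        have hz : z ≠ 0 := hz
        simp [k, L, hz]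
      simpa [k, L] using h1.congr' h2
    · intro p
      refine ⟨?_, rfl⟩
      induction p using OnePoint.rec with
      | infty => simp [k]
      | coe z => by_cases hz : z = 0 <;> simp [k, hz]

lemma P_cont (v : ℂ × ℂ) (hv : v ≠ 0) : ContinuousAt P v := by
  obtain ⟨x, y⟩ := v
  by_cases h : y = 0
  · subst h
    have hx : x ≠ 0 := by rintro rfl; exact hv rfl
    have hP : P (x, 0) = ∞ := by simp [P]
    rw [ContinuousAt, hP]
    rw [OnePoint.hasBasis_nhds_infty.tendsto_right_iff]
    rintro K ⟨-, hK⟩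
    obtain ⟨R, hR⟩ := hK.isBounded.exists_norm_le
    have hc : Continuous (fun v : ℂ × ℂ => ‖v.1‖ - R * ‖v.2‖) := by fun_prop
    have : ∀ᶠ v in 𝓝 (x, (0 : ℂ)), 0 < ‖v.1‖ - R * ‖v.2‖ :=
      hc.continuousAt.eventually (lt_mem_nhds (by simpa using hx))
    filter_upwards [this] with v hv
    by_cases h : v.2 = 0
    · right; simp [P, h]
    · left
      refine ⟨v.1 / v.2, fun hm => ?_, by simp [P, h]⟩
      have := hR _ hm
      rw [norm_div, div_le_iff₀ (norm_pos_iff.2 h)] at this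
      linarith
  · have h1 : ContinuousAt (fun v : ℂ × ℂ => ((v.1 / v.2 : ℂ) : OnePoint ℂ)) (x, y) :=
      OnePoint.continuous_coe.continuousAt.comp (continuousAt_fst.div continuousAt_snd h)
    refine h1.congr ?_
    have : ∀ᶠ v in 𝓝 (x, y), v.2 ≠ 0 := continuousAt_snd.eventually_ne h
    filter_upwards [this] with v hv
    simp [P, hv]

lemma br_cont {X : Type*} [TopologicalSpace X] {f g : X → ℂ × ℂ} {x : X}
    (hf : ContinuousAt f x) (hg : ContinuousAt g x) : ContinuousAt (fun x => br (f x) (g x)) x := by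
  unfold br; fun_prop

lemma CR_cont {X : Type*} [TopologicalSpace X] {a b c p : X → OnePoint ℂ}
    (ha : Continuous a) (hb : Continuous b) (hc : Continuous c) (hp : Continuous p)
    (hab : ∀ x, a x ≠ b x) (hpc : ∀ x, p x ≠ c x) :
    Continuous (fun x => CR (a x) (b x) (c x) (p x)) := by
  rw [continuous_iff_continuousAt]
  intro x
  obtain ⟨sa, ka, ca, ea⟩ := exists_section (a x)
  obtain ⟨sb, kb, cb, eb⟩ := exists_section (b x)
  obtain ⟨sc, kc, cc, ec⟩ := exists_section (c x)
  obtain ⟨sp, kp, cp, ep⟩ := exists_section (p x)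
  have : (fun x => CR (a x) (b x) (c x) (p x))
      = fun x => cr (sa (a x)) (sb (b x)) (sc (c x)) (sp (p x)) := by
    funext x
    have h1 := (ea (a x)).1
    have h2 := (eb (b x)).1
    have h3 := (ec (c x)).1
    have h4 := (ep (p x)).1
    have h5 := (br_L _ _).not.2 (hab x).symm
    have h6 := (br_L _ _).not.2 (hpc x)
    rw [(ea _).2, (eb _).2, (ec _).2, (ep _).2]
    simp only [CR, cr, br_smul_left, br_smul_right]
    field_simp
  rw [this]
  have ca' : ContinuousAt (fun x => sa (a x)) x := ContinuousAt.comp ca ha.continuousAt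
  have cb' : ContinuousAt (fun x => sb (b x)) x := ContinuousAt.comp cb hb.continuousAt
  have cc' : ContinuousAt (fun x => sc (c x)) x := ContinuousAt.comp cc hc.continuousAt
  have cp' : ContinuousAt (fun x => sp (p x)) x := ContinuousAt.comp cp hp.continuousAt
  refine ((br_cont cp' ca').mul (br_cont cb' cc')).div
    ((br_cont cp' cc').mul (br_cont cb' ca')) ?_
  rw [(ea _).2, (eb _).2, (ec _).2, (ep _).2]
  simp only [br_smul_left, br_smul_right]
  simp [(ea _).1, (eb _).1, (ec _).1, (ep _).1, br_L, (hab x).symm, hpc x]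

lemma IN_cont {X : Type*} [TopologicalSpace X] {a b c : X → OnePoint ℂ} {z : X → ℂ}
    (ha : Continuous a) (hb : Continuous b) (hc : Continuous c) (hz : Continuous z)
    (hab : ∀ x, a x ≠ b x) (hac : ∀ x, a x ≠ c x) (hbc : ∀ x, b x ≠ c x) :
    Continuous (fun x => IN (a x) (b x) (c x) (z x)) := by
  rw [continuous_iff_continuousAt]
  intro x
  obtain ⟨sa, ka, ca, ea⟩ := exists_section (a x)
  obtain ⟨sb, kb, cb, eb⟩ := exists_section (b x)
  obtain ⟨sc, kc, cc, ec⟩ := exists_section (c x)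
  have key : ∀ x, iv (sa (a x)) (sb (b x)) (sc (c x)) (z x)
      = (ka (a x) * kb (b x) * kc (c x)) • iv (L (a x)) (L (b x)) (L (c x)) (z x) := by
    intro x
    rw [(ea _).2, (eb _).2, (ec _).2]
    simp only [iv, br_smul_left, br_smul_right, smul_smul, smul_add]
    congr 2 <;> ring
  have hk : ∀ x, ka (a x) * kb (b x) * kc (c x) ≠ 0 := fun x =>
    mul_ne_zero (mul_ne_zero (ea _).1 (eb _).1) (ec _).1
  have : (fun x => IN (a x) (b x) (c x) (z x))
      = fun x => P (iv (sa (a x)) (sb (b x)) (sc (c x)) (z x)) := by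
    funext x
    rw [key, P_smul _ (hk x), IN]
  rw [this]
  have ca' : ContinuousAt (fun x => sa (a x)) x := ContinuousAt.comp ca ha.continuousAt
  have cb' : ContinuousAt (fun x => sb (b x)) x := ContinuousAt.comp cb hb.continuousAt
  have cc' : ContinuousAt (fun x => sc (c x)) x := ContinuousAt.comp cc hc.continuousAt
  refine ContinuousAt.comp (g := P) (P_cont _ ?_) ?_
  · rw [key]
    exact smul_ne_zero (hk x) (iv_ne (hab x) (hac x) (hbc x) _)
  · exact ((br_cont cb' cc').smul ca').add
      ((hz.continuousAt.mul (br_cont ca' cb')).smul cc')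

lemma ne3 (g : ConfSpace 3 (OnePoint ℂ)) : g.1 0 ≠ g.1 1 ∧ g.1 0 ≠ g.1 2 ∧ g.1 1 ≠ g.1 2 :=
  ⟨g.2 _ _ (by decide), g.2 _ _ (by decide), g.2 _ _ (by decide)⟩

variable {m : ℕ}

def res (f : ConfSpace (3 + m) (OnePoint ℂ)) : ConfSpace 3 (OnePoint ℂ) :=
  ⟨fun i => f.1 (Fin.castAdd m i), fun i j h => f.2 _ _ (by simpa using h)⟩

lemma ne4 (f : ConfSpace (3 + m) (OnePoint ℂ)) (i : Fin m) (j : Fin 3) :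
    f.1 (Fin.natAdd 3 i) ≠ (res f).1 j := by
  refine f.2 _ _ ?_
  intro h
  have := congrArg Fin.val h
  simp at this
  omega

def fwd (f : ConfSpace (3 + m) (OnePoint ℂ)) : ConfSpace m {z : ℂ // z ≠ 0 ∧ z ≠ 1} :=
  ⟨fun i => ⟨CR ((res f).1 0) ((res f).1 1) ((res f).1 2) (f.1 (Fin.natAdd 3 i)), by
    obtain ⟨h1, h2, h3⟩ := ne3 (res f)
    exact ⟨CR_ne_zero h1 h2 h3 _ (ne4 f i 0) (ne4 f i 2),
      CR_ne_one h1 h2 h3 _ (ne4 f i 1) (ne4 f i 2)⟩⟩, by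
    intro i j hij h
    obtain ⟨h1, h2, h3⟩ := ne3 (res f)
    have h := congrArg Subtype.val h
    have h := congrArg (IN ((res f).1 0) ((res f).1 1) ((res f).1 2)) h
    simp only [IN_CR h1 h2 h3 _ (ne4 f i 2), IN_CR h1 h2 h3 _ (ne4 f j 2)] at h
    exact f.2 _ _ (by simpa using hij) h⟩

lemma IN_ne (g : ConfSpace 3 (OnePoint ℂ)) (z : {z : ℂ // z ≠ 0 ∧ z ≠ 1}) (j : Fin 3) :
    IN (g.1 0) (g.1 1) (g.1 2) z.1 ≠ g.1 j := by
  obtain ⟨h1, h2, h3⟩ := ne3 g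
  fin_cases j
  · exact IN_ne_a h1 h2 h3 _ z.2.1
  · exact IN_ne_b h1 h2 h3 _ z.2.2
  · exact IN_ne_c h1 h2 h3 _

def bwd (x : ConfSpace 3 (OnePoint ℂ) × ConfSpace m {z : ℂ // z ≠ 0 ∧ z ≠ 1}) :
    ConfSpace (3 + m) (OnePoint ℂ) :=
  ⟨Fin.append x.1.1 (fun i => IN (x.1.1 0) (x.1.1 1) (x.1.1 2) (x.2.1 i).1), by
    obtain ⟨h1, h2, h3⟩ := ne3 x.1
    intro i j
    induction i using Fin.addCases with
    | left i =>
      induction j using Fin.addCases with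
      | left j =>
        intro h
        simpa using x.1.2 i j (by simpa using h)
      | right j =>
        intro _
        simpa using (IN_ne x.1 (x.2.1 j) i).symm
    | right i =>
      induction j using Fin.addCases with
      | left j =>
        intro _
        simpa using (IN_ne x.1 (x.2.1 i) j)
      | right j =>
        intro h e
        simp only [Fin.append_right] at e
        have e := congrArg (CR (x.1.1 0) (x.1.1 1) (x.1.1 2)) e
        rw [CR_IN h1 h2 h3, CR_IN h1 h2 h3] at e
        exact x.2.2 i j (by simpa using h) (Subtype.ext e)⟩

lemma res_cont (j : Fin 3) : Continuous
    (fun f : ConfSpace (3 + m) (OnePoint ℂ) => (res f).1 j) :=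
  (continuous_apply (Fin.castAdd m j)).comp continuous_subtype_val

def homeo (m : ℕ) : ConfSpace (3 + m) (OnePoint ℂ) ≃ₜ
    ConfSpace 3 (OnePoint ℂ) × ConfSpace m {z : ℂ // z ≠ 0 ∧ z ≠ 1} where
  toFun f := (res f, fwd f)
  invFun := bwd
  left_inv f := by
    obtain ⟨h1, h2, h3⟩ := ne3 (res f)
    apply Subtype.ext
    funext i
    induction i using Fin.addCases with
    | left i => simp [bwd, res]
    | right i =>
      simp only [bwd, Fin.append_right]
      exact IN_CR h1 h2 h3 _ (ne4 f i 2)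
  right_inv x := by
    obtain ⟨h1, h2, h3⟩ := ne3 x.1
    have hr : res (bwd x) = x.1 := by
      apply Subtype.ext
      funext i
      simp [bwd, res]
    refine Prod.ext hr ?_
    apply Subtype.ext
    funext i
    apply Subtype.ext
    simp only [fwd, hr]
    simp only [bwd, Fin.append_right]
    exact CR_IN h1 h2 h3 _
  continuous_toFun := by
    refine Continuous.prodMk ?_ ?_
    · exact Continuous.subtype_mk (continuous_pi fun j => res_cont j) _
    · refine Continuous.subtype_mk (continuous_pi fun i => Continuous.subtype_mk ?_ _) _
      exact CR_cont (res_cont 0) (res_cont 1) (res_cont 2)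
        ((continuous_apply _).comp continuous_subtype_val)
        (fun f => (ne3 (res f)).1) (fun f => ne4 f i 2)
  continuous_invFun := by
    have hg : ∀ j : Fin 3, Continuous (fun x : ConfSpace 3 (OnePoint ℂ) ×
        ConfSpace m {z : ℂ // z ≠ 0 ∧ z ≠ 1} => x.1.1 j) := fun j =>
      (continuous_apply _).comp (continuous_subtype_val.comp continuous_fst)
    refine Continuous.subtype_mk (continuous_pi fun i => ?_) _
    induction i using Fin.addCases with
    | left i => simpa using hg i
    | right i =>
      simp only [Fin.append_right]
      refine IN_cont (hg 0) (hg 1) (hg 2) ?_ (fun x => (ne3 x.1).1) (fun x => (ne3 x.1).2.1)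
        (fun x => (ne3 x.1).2.2)
      exact continuous_subtype_val.comp
        ((continuous_apply i).comp (continuous_subtype_val.comp continuous_snd))

end

end Conf13

/-- For every `n ≥ 3` there is a homeomorphism
`C_n(ℙ¹) ≅ C₃(ℙ¹) × C_{n-3}(ℂ ∖ {0,1})`. -/
theorem stmt_13 (n : ℕ) (hn : 3 ≤ n) :
    Nonempty (ConfSpace n RiemannSphere ≃ₜ
      ConfSpace 3 RiemannSphere × ConfSpace (n - 3) {z : ℂ // z ≠ 0 ∧ z ≠ 1}) := by
  obtain ⟨m, rfl⟩ := Nat.exists_eq_add_of_le hn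
  rw [Nat.add_sub_cancel_left]
  exact ⟨Conf13.homeo m⟩
end

section
/- For n ≥ 1, the projection π^n : C_{n+1}(S²) → C_n(S²) onto the first n coordinates admits a continuous cross-section if and only if n ≠ 2. In particular: the map x ↦ (x, −x) is a cross-section of C₂(S²) → S²; for n ≥ 3 a cross-section exists; and there is no continuous map s : C₂(S²) → C₃(S²) with π² ∘ s = id. -/
/-- The ordered configuration space of `n` points of the 2-sphere. -/
abbrev ConfS2 (n : ℕ) : Type :=
  {f : Fin n → ↥TwoSphere // ∀ i j : Fin n, i ≠ j → f i ≠ f j}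

/-- The projection `π^n : C_{n+1}(S²) → C_n(S²)` onto the first `n`
coordinates. -/
def projS2 (n : ℕ) (q : ConfS2 (n + 1)) : ConfS2 n :=
  ⟨fun i => q.val i.castSucc, fun i j hij =>
    q.2 i.castSucc j.castSucc fun h => hij (Fin.castSucc_injective n h)⟩

open Complex in
theorem aux_log (v : ℂ → ℂ) (hv : Continuous v) (h0 : ∀ z, v z ≠ 0) :
    ∃ g : ℂ → ℂ, Continuous g ∧ ∀ z, Complex.exp (g z) = v z := by
  obtain ⟨F, ⟨-, hF⟩, -⟩ := isCoveringMapOn_exp.existsUnique_continuousMap_lifts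
    (A := ℂ) ⟨v, hv⟩ (a₀ := 0) (e₀ := Complex.log (v 0)) (Complex.exp_log (h0 0))
    (fun a => h0 a)
  exact ⟨F, F.continuous, fun z => congrFun hF z⟩

theorem aux_const (d : ℝ → ℂ) (hd : Continuous d) (h : ∀ t, Complex.exp (d t) = 1) (t : ℝ) :
    d t = d 0 := by
  have := Complex.isCoveringMap_exp.eq_of_comp_eq (g₁ := d) (g₂ := fun _ => d 0) hd
    continuous_const (by funext t; simp [h]) 0 rfl
  exact congrFun this t

theorem aux_dep (x y a b c : ℝ)
    (h1 : a * (1 - x^2 + y^2) - 2 * b * (x * y) - 2 * c * x = 0)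
    (h2 : - 2 * a * (x * y) + b * (1 + x^2 - y^2) - 2 * c * y = 0)
    (hn : a^2 + b^2 + c^2 = 1) :
    ∃ ε : ℝ, (ε = 1 ∨ ε = -1) ∧ a = ε * (2 * x / (1 + x^2 + y^2)) ∧
      b = ε * (2 * y / (1 + x^2 + y^2)) ∧ c = ε * ((1 - x^2 - y^2) / (1 + x^2 + y^2)) := by
  have hr : (0:ℝ) < 1 + x^2 + y^2 := by positivity
  set r := 1 + x^2 + y^2 with hrdef
  have c1 : a * (2 * y) = b * (2 * x) := by
    have : r * (a * (2 * y)) = r * (b * (2 * x)) := by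
      rw [hrdef]; linear_combination (2 * y) * h1 - (2 * x) * h2
    exact mul_left_cancel₀ hr.ne' this
  have c2 : a * (1 - x^2 - y^2) = c * (2 * x) := by
    have : r * (a * (1 - x^2 - y^2)) = r * (c * (2 * x)) := by
      rw [hrdef]; linear_combination (1 + x^2 - y^2) * h1 + (2 * x * y) * h2
    exact mul_left_cancel₀ hr.ne' this
  have c3 : b * (1 - x^2 - y^2) = c * (2 * y) := by
    have : r * (b * (1 - x^2 - y^2)) = r * (c * (2 * y)) := by
      rw [hrdef]; linear_combination (2 * x * y) * h1 + (1 - x^2 + y^2) * h2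
    exact mul_left_cancel₀ hr.ne' this
  refine ⟨(a * (2*x) + b * (2*y) + c * (1 - x^2 - y^2)) / r, ?_, ?_, ?_, ?_⟩
  · rw [← sq_eq_one_iff, div_pow, div_eq_one_iff_eq (by positivity), hrdef]
    linear_combination (1 + x^2+y^2)^2 * hn - (a * (2*y) - b * (2*x)) * c1
      - (a * (1 - x^2 - y^2) - c * (2 * x)) * c2 - (b * (1 - x^2 - y^2) - c * (2 * y)) * c3
  · field_simp
    rw [hrdef]
    linear_combination (2*y) * c1 + (1 - x^2 - y^2) * c2
  · field_simp
    rw [hrdef]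
    linear_combination -(2*x) * c1 + (1 - x^2 - y^2) * c3
  · field_simp
    rw [hrdef]
    linear_combination -(2*x) * c2 - (2*y) * c3

/-- Inverse stereographic projection, with a sign on the last coordinate. -/
noncomputable def stV (σ : ℝ) (z : ℂ) : EuclideanSpace ℝ (Fin 3) :=
  !₂[2 * z.re / (1 + z.re^2 + z.im^2), 2 * z.im / (1 + z.re^2 + z.im^2),
    σ * ((1 - z.re^2 - z.im^2) / (1 + z.re^2 + z.im^2))]

theorem stV_mem (σ : ℝ) (hσ : σ^2 = 1) (z : ℂ) : stV σ z ∈ TwoSphere := by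
  have hr : (0:ℝ) < 1 + z.re^2 + z.im^2 := by positivity
  rw [mem_sphere_zero_iff_norm, EuclideanSpace.norm_eq, Real.sqrt_eq_one]
  simp only [Fin.sum_univ_three, stV, Real.norm_eq_abs, sq_abs]
  simp only [PiLp.toLp_apply, Matrix.cons_val]
  rw [mul_pow, hσ]
  field_simp
  ring

noncomputable def stS (σ : ℝ) (hσ : σ^2 = 1) (z : ℂ) : TwoSphere := ⟨stV σ z, stV_mem σ hσ z⟩

theorem stS_cont (σ : ℝ) (hσ : σ^2 = 1) : Continuous (stS σ hσ) := by
  have hr : ∀ z : ℂ, (1 + z.re^2 + z.im^2) ≠ 0 := fun z => by positivity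
  refine Continuous.subtype_mk ?_ _
  unfold stV
  refine (PiLp.continuous_toLp 2 _).comp (continuous_pi fun i => ?_)
  have := Complex.continuous_re
  have := Complex.continuous_im
  fin_cases i <;> simp <;> fun_prop (disch := exact hr _)

/-- The vector field in coordinates. -/
noncomputable def vF (σ : ℝ) (hσ : σ^2 = 1) (f : TwoSphere → TwoSphere) (z : ℂ) : ℂ :=
  ((f (stS σ hσ z)).1 0 : ℂ) * (1 - z^2) + ((f (stS σ hσ z)).1 1 : ℂ) * (Complex.I * (1 + z^2))
    - σ * ((f (stS σ hσ z)).1 2 : ℂ) * (2 * z)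

theorem vF_cont (σ : ℝ) (hσ : σ^2 = 1) (f : TwoSphere → TwoSphere) (hf : Continuous f) :
    Continuous (vF σ hσ f) := by
  have h1 : Continuous fun z => (f (stS σ hσ z)).1 :=
    continuous_subtype_val.comp (hf.comp (stS_cont σ hσ))
  have h2 : ∀ i, Continuous fun z => ((f (stS σ hσ z)).1 i : ℂ) := fun i =>
    Complex.continuous_ofReal.comp ((EuclideanSpace.proj (𝕜 := ℝ) i).continuous.comp h1)
  have a0 := h2 0
  have a1 := h2 1
  have a2 := h2 2
  unfold vF
  fun_prop

theorem sq_sum (y : TwoSphere) : (y.1 0)^2 + (y.1 1)^2 + (y.1 2)^2 = 1 := by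
  have h := y.2
  rw [mem_sphere_zero_iff_norm, EuclideanSpace.norm_eq, Real.sqrt_eq_one] at h
  simpa [Fin.sum_univ_three] using h

theorem vF_ne (σ : ℝ) (hσ : σ^2 = 1) (f : TwoSphere → TwoSphere)
    (h1 : ∀ x, f x ≠ x) (h2 : ∀ x, f x ≠ -x) (z : ℂ) : vF σ hσ f z ≠ 0 := by
  intro h
  have hre := congrArg Complex.re h
  have him := congrArg Complex.im h
  simp [vF, pow_two] at hre him
  obtain ⟨ε, hε, e0, e1, e2⟩ := aux_dep z.re z.im ((f (stS σ hσ z)).1 0) ((f (stS σ hσ z)).1 1)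
    (σ * (f (stS σ hσ z)).1 2) (by linear_combination hre) (by linear_combination him)
    (by rw [mul_pow, hσ]; linear_combination sq_sum (f (stS σ hσ z)))
  have e2' : (f (stS σ hσ z)).1 2 = ε * (σ * ((1 - z.re^2 - z.im^2) / (1 + z.re^2 + z.im^2))) := by
    linear_combination σ * e2 - ((f (stS σ hσ z)).1 2) * hσ
  have key : (f (stS σ hσ z)).1 = ε • (stS σ hσ z).1 := by
    ext i
    fin_cases i
    · simpa [stS, stV] using e0
    · simpa [stS, stV] using e1
    · simpa [stS, stV] using e2'
  rcases hε with rfl | rfl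
  · exact h1 _ (Subtype.ext (by simpa using key))
  · exact h2 _ (Subtype.ext (by simpa using key))

theorem hairy (f : TwoSphere → TwoSphere) (hf : Continuous f)
    (h1 : ∀ x, f x ≠ x) (h2 : ∀ x, f x ≠ -x) : False := by
  have hp : (1:ℝ)^2 = 1 := by norm_num
  have hm : (-1:ℝ)^2 = 1 := by norm_num
  obtain ⟨g, hg, hg'⟩ := aux_log _ (vF_cont 1 hp f hf) (vF_ne 1 hp f h1 h2)
  obtain ⟨k, hk, hk'⟩ := aux_log _ (vF_cont (-1) hm f hf) (vF_ne (-1) hm f h1 h2)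
  let e : ℝ → ℂ := fun t => Complex.exp (t * Complex.I)
  have he : Continuous e := by fun_prop
  have hst : ∀ t, stS 1 hp (e t) = stS (-1) hm (e t) := by
    intro t
    have : 1 - (e t).re^2 - (e t).im^2 = 0 := by
      simp only [e, Complex.exp_ofReal_mul_I_re, Complex.exp_ofReal_mul_I_im]
      linarith [Real.sin_sq_add_cos_sq t]
    apply Subtype.ext
    simp [stS, stV, this]
  have hconj : ∀ t, (e t) * (starRingEnd ℂ) (e t) = 1 := by
    intro t
    rw [Complex.mul_conj, Complex.normSq_eq_norm_sq]
    simp [e, Complex.norm_exp_ofReal_mul_I]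
  have hrel : ∀ t, vF (-1) hm f (e t) = -(e t)^2 * (starRingEnd ℂ) (vF 1 hp f (e t)) := by
    intro t
    have hc := hconj t
    simp only [vF, hst t, map_add, map_sub, map_mul, Complex.conj_ofReal, map_one, map_pow,
      Complex.conj_I, map_ofNat]
    set w := (starRingEnd ℂ) (e t)
    set a : ℂ := ((f (stS (-1) hm (e t))).1 0 : ℂ)
    set b : ℂ := ((f (stS (-1) hm (e t))).1 1 : ℂ)
    set c : ℂ := ((f (stS (-1) hm (e t))).1 2 : ℂ)
    push_cast
    linear_combination (-(a * (e t * w + 1)) - b * Complex.I * (e t * w + 1) - 2 * c * e t) * hc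
  let d : ℝ → ℂ := fun t =>
    k (e t) - (starRingEnd ℂ) (g (e t)) - 2 * (t * Complex.I) - Real.pi * Complex.I
  have hd : Continuous d := by
    have := Complex.continuous_conj
    fun_prop
  have hd1 : ∀ t, Complex.exp (d t) = 1 := by
    intro t
    have hne : (starRingEnd ℂ) (vF 1 hp f (e t)) ≠ 0 := by
      simpa using vF_ne 1 hp f h1 h2 (e t)
    have hee : e t ≠ 0 := Complex.exp_ne_zero _
    have h22 : Complex.exp (2 * (t * Complex.I)) = (e t)^2 := by
      rw [← Complex.exp_nat_mul]; norm_num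
    simp only [d, Complex.exp_sub, ← Complex.exp_conj] 
    rw [Complex.exp_conj, hk', hg', hrel, h22, Complex.exp_pi_mul_I]
    field_simp
  have := aux_const d hd hd1 (2 * Real.pi)
  have e2 : e (2 * Real.pi) = e 0 := by simp [e]
  simp only [d, e2] at this
  have h3 := congrArg Complex.im this
  simp at h3

theorem mkSection {n : ℕ} (q : ConfS2 n → TwoSphere) (hq : Continuous q)
    (h : ∀ p i, q p ≠ p.val i) :
    ∃ s : ConfS2 n → ConfS2 (n + 1), Continuous s ∧ (∀ p, projS2 n (s p) = p) ∧
      ∀ p, (s p).val (Fin.last n) = q p := by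
  refine ⟨fun p => ⟨Fin.snoc (α := fun _ => TwoSphere) p.val (q p), ?_⟩, ?_, ?_, ?_⟩
  · intro i j
    refine Fin.lastCases ?_ (fun i => ?_) i <;> refine Fin.lastCases ?_ (fun j => ?_) j
    · simp
    · intro _; simpa using h p j
    · intro _; simpa using (h p i).symm
    · intro hij; simpa using p.2 i j (fun h => hij (by rw [h]))
  · exact Continuous.subtype_mk (Continuous.finSnoc (A := fun _ => TwoSphere) continuous_subtype_val hq) _
  · intro p; apply Subtype.ext; funext i; simp [projS2]
  · intro p; simp

theorem sec1 : ∃ s : ConfS2 1 → ConfS2 2,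
        Continuous s ∧ (∀ p, projS2 1 (s p) = p) ∧
        ∀ p : ConfS2 1, (s p).val 1 = -(p.val 0) := by
  refine mkSection (n := 1) (fun p => -(p.val 0)) ?_ ?_
  · exact continuous_neg.comp ((continuous_apply 0).comp continuous_subtype_val)
  · intro p i
    rw [Subsingleton.elim i 0]
    exact (ne_neg_of_mem_unit_sphere ℝ (p.val 0)).symm

theorem sec3 (m : ℕ) : ∃ s : ConfS2 (m+3) → ConfS2 (m + 3 + 1),
        Continuous s ∧ (∀ p, projS2 (m+3) (s p) = p) := by
  let P : ConfS2 (m+3) → Fin (m+3) → EuclideanSpace ℝ (Fin 3) := fun p i => (p.val i).1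
  have hP : ∀ i, Continuous fun p => P p i := fun i =>
    continuous_subtype_val.comp ((continuous_apply i).comp continuous_subtype_val)
  have hPn : ∀ p i, ‖P p i‖ = 1 := fun p i => mem_sphere_zero_iff_norm.1 (p.val i).2
  have hPd : ∀ p i j, i ≠ j → P p i - P p j ≠ 0 := fun p i j hij h =>
    p.2 i j hij (Subtype.ext (sub_eq_zero.1 h))
  let a : ConfS2 (m+3) → Fin (m+3) → EuclideanSpace ℝ (Fin 3) := fun p i =>
    (‖P p i - P p 0‖^2)⁻¹ • (P p i - P p 0)
  have ha : ∀ i, i ≠ 0 → Continuous fun p => a p i := fun i hi => by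
    have h0 := hP 0
    have h1 := hP i
    refine Continuous.smul (Continuous.inv₀ ((h1.sub h0).norm.pow 2) fun p => ?_) (h1.sub h0)
    exact pow_ne_zero 2 (norm_ne_zero_iff.2 (hPd p i 0 hi))
  have hin : ∀ p i, i ≠ 0 → inner ℝ (P p 0) (a p i) = -(1/2) := fun p i hi => by
    have := norm_pos_iff.2 (hPd p i 0 hi)
    have e : ‖P p i - P p 0‖^2 = 2 - 2 * inner ℝ (P p 0) (P p i) := by
      rw [@norm_sub_sq_real, hPn, hPn, real_inner_comm]; ring
    simp only [a, inner_smul_right, inner_sub_right, real_inner_self_eq_norm_sq, hPn]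
    field_simp
    rw [e]; ring
  have han : ∀ p i, i ≠ 0 → (‖a p i‖^2)⁻¹ • a p i = P p i - P p 0 := fun p i hi => by
    have := norm_pos_iff.2 (hPd p i 0 hi)
    simp only [a, norm_smul, norm_inv, norm_pow, norm_norm, smul_smul]
    convert one_smul ℝ _ using 2
    field_simp
  have h10 : (1 : Fin (m+3)) ≠ 0 := by simp
  have h20 : (2 : Fin (m+3)) ≠ 0 := by
    intro h; have := congrArg Fin.val h; 
    simp at this; rw [Nat.mod_eq_of_lt (by omega)] at this; omega
  have h12 : (2 : Fin (m+3)) ≠ 1 := by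
    intro h; have := congrArg Fin.val h; 
    simp at this; rw [Nat.mod_eq_of_lt (by omega)] at this; omega
  let w : ConfS2 (m+3) → EuclideanSpace ℝ (Fin 3) := fun p => a p 2 - a p 1
  have hw : Continuous w := (ha 2 h20).sub (ha 1 h10)
  have hw0 : ∀ p, w p ≠ 0 := fun p h => by
    have h' : a p 2 = a p 1 := sub_eq_zero.1 h
    have e1 := han p 1 h10
    rw [← h', han p 2 h20] at e1
    exact hPd p 2 1 h12 (by rw [sub_eq_zero]; exact sub_left_injective e1)
  have hwi : ∀ p, inner ℝ (P p 0) (w p) = 0 := fun p => by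
    simp only [w, inner_sub_right, hin p 2 h20, hin p 1 h10]; ring
  let L : ConfS2 (m+3) → ℝ := fun p => (1 + ∑ i ∈ Finset.univ.erase 0, ‖a p i‖)
  have hL : Continuous L := continuous_const.add (continuous_finsetSum _ fun i hi =>
    (ha i (Finset.ne_of_mem_erase hi)).norm)
  have hLp : ∀ p, 0 < L p := fun p => by positivity
  let c : ConfS2 (m+3) → EuclideanSpace ℝ (Fin 3) := fun p =>
    (L p * ‖w p‖⁻¹) • w p - (1/2 : ℝ) • P p 0
  have hc : Continuous c := by
    have h0 := hP 0
    have h3 : Continuous fun p => (1/2 : ℝ) • P p 0 := by fun_prop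
    exact ((hL.mul (hw.norm.inv₀ fun p => norm_ne_zero_iff.2 (hw0 p))).smul hw).sub
      h3
  have hci : ∀ p, inner ℝ (P p 0) (c p) = -(1/2) := fun p => by
    simp only [c, inner_sub_right, inner_smul_right, hwi, real_inner_self_eq_norm_sq, hPn]; ring
  have hcn : ∀ p, ‖c p‖^2 = (L p)^2 + 1/4 := fun p => by
    have := norm_pos_iff.2 (hw0 p)
    simp only [c]
    rw [@norm_sub_sq_real, inner_smul_left, inner_smul_right, real_inner_comm, hwi, norm_smul,
      norm_smul, hPn]
    simp only [norm_mul, norm_inv, norm_norm, Real.norm_eq_abs, abs_of_pos (hLp p), abs_of_pos this]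
    rw [abs_of_pos (by norm_num : (0:ℝ) < 1/2)]
    field_simp
    ring
  have hc0 : ∀ p, 0 < ‖c p‖^2 := fun p => by rw [hcn]; positivity
  let Q : ConfS2 (m+3) → EuclideanSpace ℝ (Fin 3) := fun p => P p 0 + (‖c p‖^2)⁻¹ • c p
  have hQ : Continuous Q :=
    (hP 0).add (((hc.norm.pow 2).inv₀ fun p => (hc0 p).ne').smul hc)
  have hQm : ∀ p, Q p ∈ TwoSphere := fun p => by
    have h : ‖Q p‖^2 = 1 := by
      have := hc0 p
      simp only [Q]
      rw [@norm_add_sq_real, inner_smul_right, hci, norm_smul, hPn, norm_inv, norm_pow, norm_norm]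
      field_simp
      ring
    rw [mem_sphere_zero_iff_norm]
    exact (pow_eq_one_iff_of_nonneg (norm_nonneg _) two_ne_zero).1 h
  obtain ⟨s, hs, hs', -⟩ := mkSection (n := m+3) (fun p => ⟨Q p, hQm p⟩) (hQ.subtype_mk _) (by
    intro p i hi
    have hi' : (‖c p‖^2)⁻¹ • c p = P p i - P p 0 :=
      eq_sub_of_add_eq' (congrArg Subtype.val hi)
    have hcne : c p ≠ 0 := fun h => by have := hc0 p; simp [h] at this
    by_cases h0 : i = 0
    · subst h0
      rw [sub_self, smul_eq_zero] at hi'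
      rcases hi' with h | h
      · exact (inv_ne_zero (hc0 p).ne') h
      · exact hcne h
    · rw [← han p i h0] at hi'
      have hn := congrArg norm hi'
      have hapos : a p i ≠ 0 := fun h => by have := hin p i h0; simp [h] at this
      have := norm_pos_iff.2 hapos
      have := norm_pos_iff.2 hcne
      simp only [norm_smul, norm_inv, norm_pow, norm_norm] at hn
      field_simp at hn
      have hle : ‖a p i‖ ≤ ∑ i ∈ Finset.univ.erase 0, ‖a p i‖ :=
        Finset.single_le_sum (f := fun i => ‖a p i‖) (fun _ _ => norm_nonneg _)
          (Finset.mem_erase.2 ⟨h0, Finset.mem_univ _⟩)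
      have hlt : ‖a p i‖ < L p := by simp only [L]; linarith
      have := hcn p
      nlinarith)
  exact ⟨s, hs, hs'⟩

theorem nosec2 (s : ConfS2 2 → ConfS2 3) (hs : Continuous s) (h : ∀ p, projS2 2 (s p) = p) :
    False := by
  let D : TwoSphere → ConfS2 2 := fun x => ⟨![x, -x], by
    have := ne_neg_of_mem_unit_sphere ℝ x
    intro i j hij
    fin_cases i <;> fin_cases j <;> simp at hij ⊢
    · exact this
    · exact this.symm⟩
  have hD : Continuous D := by
    refine Continuous.subtype_mk (continuous_pi fun i => ?_) _
    fin_cases i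
    · exact continuous_id
    · exact continuous_neg
  have hc : ∀ x i, (s (D x)).val (Fin.castSucc i) = (D x).val i := fun x i =>
    congrFun (congrArg Subtype.val (h (D x))) i
  refine hairy (fun x => (s (D x)).val 2) ?_ ?_ ?_
  · exact (continuous_apply 2).comp (continuous_subtype_val.comp (hs.comp hD))
  · intro x hx
    exact (s (D x)).2 2 0 (by decide) (hx.trans (hc x 0).symm)
  · intro x hx
    exact (s (D x)).2 2 1 (by decide) (hx.trans (hc x 1).symm)

/-- For `n ≥ 1`, the projection `π^n : C_{n+1}(S²) → C_n(S²)` admits a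
continuous cross-section if and only if `n ≠ 2`; moreover `x ↦ (x, -x)` gives a
cross-section of `C₂(S²) → S²` (the case `n = 1`). -/
theorem stmt_15 :
    (∀ n : ℕ, 1 ≤ n →
      ((∃ s : ConfS2 n → ConfS2 (n + 1),
          Continuous s ∧ ∀ p, projS2 n (s p) = p) ↔ n ≠ 2)) ∧
    (∃ s : ConfS2 1 → ConfS2 2,
        Continuous s ∧ (∀ p, projS2 1 (s p) = p) ∧
        ∀ p : ConfS2 1, (s p).val 1 = -(p.val 0)) := by
  refine ⟨fun n hn => ⟨?_, ?_⟩, sec1⟩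
  · rintro ⟨s, hs, h⟩ rfl
    exact nosec2 s hs h
  · intro h2
    rcases Nat.lt_or_ge n 3 with h | h
    · obtain rfl : n = 1 := by omega
      obtain ⟨s, hs, h, -⟩ := sec1
      exact ⟨s, hs, h⟩
    · obtain ⟨m, rfl⟩ := Nat.exists_eq_add_of_le' h
      exact sec3 m
end

section
/- For n ≥ 1, the projection π^n : C_{n+1}^±(S²) → C_n^±(S²) onto the first n coordinates admits a continuous cross-section if and only if n ≥ 2. In particular there is no continuous map s : C₁^±(S²) = S² → C₂^±(S²) with π¹ ∘ s = id. -/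
/-- The orbit configuration space `C_n^±(S²)` of `n` ordered points of the
2-sphere, pairwise neither equal nor antipodal. -/
abbrev ConfPM (n : ℕ) : Type :=
  {f : Fin n → ↥TwoSphere // ∀ i j : Fin n, i ≠ j → f i ≠ f j ∧ f i ≠ -f j}

/-- The projection `π^n : C_{n+1}^±(S²) → C_n^±(S²)` onto the first `n`
coordinates. -/
def projPM (n : ℕ) (q : ConfPM (n + 1)) : ConfPM n :=
  ⟨fun i => q.val i.castSucc, fun i j hij =>
    q.2 i.castSucc j.castSucc fun h => hij (Fin.castSucc_injective n h)⟩

namespace HB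
open Complex

theorem exists_log (g : ℂ → ℂ) (hg : Continuous g) (h0 : ∀ z, g z ≠ 0) :
    ∃ G : ℂ → ℂ, Continuous G ∧ ∀ z, exp (G z) = g z := by
  let f : C(ℂ, {z : ℂ // z ≠ 0}) := ⟨fun z => ⟨g z, h0 z⟩, by fun_prop⟩
  obtain ⟨F, ⟨-, hF⟩, -⟩ := isCoveringMap_exp.existsUnique_continuousMap_lifts f 0 (log (g 0))
    (by apply Subtype.ext; simp [f, exp_log (h0 0)])
  refine ⟨F, F.continuous, fun z => ?_⟩
  have := congrArg Subtype.val (congrFun hF z)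
  simpa [f] using this

theorem no_logs (g h : ℂ → ℂ) (hg : Continuous g) (hh : Continuous h)
    (hg0 : ∀ z, g z ≠ 0) (hh0 : ∀ z, h z ≠ 0)
    (H : ∀ z : ℂ, ‖z‖ = 1 → g z = - z ^ 2 * (starRingEnd ℂ) (h z)) : False := by
  obtain ⟨G, hG, hG'⟩ := exists_log g hg hg0
  obtain ⟨K, hK, hK'⟩ := exists_log h hh hh0
  let L : ℝ → ℂ := fun t => G (exp (t * I)) - (starRingEnd ℂ) (K (exp (t * I))) - 2 * (t * I)
  have hL : Continuous L := by
    have h1 : Continuous fun t : ℝ => exp ((t : ℂ) * I) := by fun_prop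
    have h2 := continuous_conj.comp (hK.comp h1)
    exact ((hG.comp h1).sub h2).sub (by fun_prop)
  have hexp : ∀ t, exp (L t) = -1 := by
    intro t
    have hz : ‖exp ((t : ℂ) * I)‖ = 1 := norm_exp_ofReal_mul_I t
    have e1 := H _ hz
    have hne : (starRingEnd ℂ) (h (exp (t * I))) ≠ 0 := by simpa using hh0 _
    simp only [L]
    rw [exp_sub, exp_sub, hG', exp_conj, hK', e1, ← exp_nat_mul]
    push_cast
    have := exp_ne_zero (2 * ((t : ℂ) * I))
    field_simp
  have hconst : L = fun _ => L 0 := by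
    refine isCoveringMap_exp.eq_of_comp_eq hL continuous_const ?_ 0 rfl
    funext t
    apply Subtype.ext
    simp [hexp]
  have h2 := congrFun hconst (2 * Real.pi)
  have e : exp (((2 * Real.pi : ℝ) : ℂ) * I) = exp (((0 : ℝ) : ℂ) * I) := by
    push_cast
    rw [exp_two_pi_mul_I]; simp
  simp only [L, e] at h2
  have h3 := congrArg Complex.im h2
  simp at h3

/-- first chart expression -/
theorem nonvan (x y z a b c d : ℝ) (hp : x ^ 2 + y ^ 2 + z ^ 2 = 1)
    (hb : a ^ 2 + b ^ 2 + c ^ 2 = 1) (hd : d = a * x + b * y + c * z)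
    (hz : 1 + z ≠ 0) (h1 : ¬ (a = x ∧ b = y ∧ c = z)) (h2 : ¬ (a = -x ∧ b = -y ∧ c = -z)) :
    (((1 + z) * (a - d * x) - (c - d * z) * x : ℝ) : ℂ)
      + ((1 + z) * (b - d * y) - (c - d * z) * y : ℝ) * I ≠ 0 := by
  intro h
  have hr := congrArg Complex.re h
  have hi := congrArg Complex.im h
  simp only [add_re, ofReal_re, mul_re, I_re, mul_zero, ofReal_im, I_im, mul_one, sub_self,
    add_zero, zero_re, add_im, mul_im, zero_im, zero_add] at hr hi
  have key : (1 + z) ^ 2 * ((a - d * x) ^ 2 + (b - d * y) ^ 2 + (c - d * z) ^ 2) = 0 := by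
    have ht : (a - d * x) * x + (b - d * y) * y + (c - d * z) * z = 0 := by
      linear_combination -d * hp - hd
    generalize a - d * x = u at *
    generalize b - d * y = v at *
    generalize c - d * z = w at *
    linear_combination ((1 + z) * u - w * x) * hr + ((1 + z) * v - w * y) * hi
      + 2 * (1 + z) * w * ht - w ^ 2 * hp
  have key2 : (a - d * x) ^ 2 + (b - d * y) ^ 2 + (c - d * z) ^ 2 = 0 := by
    rcases mul_eq_zero.mp key with h | h
    · exact absurd (pow_eq_zero_iff (two_ne_zero) |>.mp h) hz
    · exact h
  have k1 : a = d * x := by nlinarith [sq_nonneg (a - d * x), sq_nonneg (b - d * y), sq_nonneg (c - d * z)]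
  have k2 : b = d * y := by nlinarith [sq_nonneg (a - d * x), sq_nonneg (b - d * y), sq_nonneg (c - d * z)]
  have k3 : c = d * z := by nlinarith [sq_nonneg (a - d * x), sq_nonneg (b - d * y), sq_nonneg (c - d * z)]
  have hd2 : d ^ 2 = 1 := by
    rw [k1, k2, k3] at hb
    linear_combination hb - d ^ 2 * hp
  have hd3 : d * d = 1 := by rw [← sq]; exact hd2
  rcases mul_self_eq_one_iff.mp hd3 with h | h
  · exact h1 (by rw [k1, k2, k3, h]; simp)
  · exact h2 (by rw [k1, k2, k3, h]; simp)

theorem mem_iff (v : EuclideanSpace ℝ (Fin 3)) :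
    v ∈ TwoSphere ↔ v 0 ^ 2 + v 1 ^ 2 + v 2 ^ 2 = 1 := by
  rw [mem_sphere_zero_iff_norm, EuclideanSpace.norm_eq, Real.sqrt_eq_one, Fin.sum_univ_three]
  simp


/-- stereographic parametrisations -/
noncomputable def st (σ : ℝ) (hσ : σ ^ 2 = 1) (ζ : ℂ) : TwoSphere :=
  ⟨!₂[2 * ζ.re / (1 + normSq ζ), 2 * ζ.im / (1 + normSq ζ),
      σ * (1 - normSq ζ) / (1 + normSq ζ)], by
    rw [mem_iff]
    have h : (1 + normSq ζ) ≠ 0 := by have := normSq_nonneg ζ; positivity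
    simp only [PiLp.toLp_apply, Matrix.cons_val]
    field_simp
    rw [hσ, normSq_apply]
    ring⟩

theorem st_cont (σ : ℝ) (hσ : σ ^ 2 = 1) : Continuous (st σ hσ) := by
  unfold st
  refine Continuous.subtype_mk ?_ _
  have h : ∀ ζ : ℂ, (1 + normSq ζ) ≠ 0 := fun ζ => by have := normSq_nonneg ζ; positivity
  have hn : Continuous fun ζ : ℂ => normSq ζ := continuous_normSq
  have h1 : Continuous fun ζ : ℂ => 2 * ζ.re / (1 + normSq ζ) :=
    Continuous.div (by fun_prop) (by fun_prop) h
  have h2 : Continuous fun ζ : ℂ => 2 * ζ.im / (1 + normSq ζ) :=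
    Continuous.div (by fun_prop) (by fun_prop) h
  have h3 : Continuous fun ζ : ℂ => σ * (1 - normSq ζ) / (1 + normSq ζ) :=
    Continuous.div (by fun_prop) (by fun_prop) h
  refine (PiLp.continuous_toLp 2 _).comp (continuous_pi fun i => ?_)
  fin_cases i
  · exact h1
  · exact h2
  · exact h3

/-- inner product in coordinates -/
def dt (p b : EuclideanSpace ℝ (Fin 3)) : ℝ := b 0 * p 0 + b 1 * p 1 + b 2 * p 2

/-- the chart expression of the tangent field -/
noncomputable def ch (σ : ℝ) (p b : EuclideanSpace ℝ (Fin 3)) : ℂ :=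
  (((1 + σ * p 2) * (b 0 - dt p b * p 0) - (σ * b 2 - dt p b * (σ * p 2)) * p 0 : ℝ) : ℂ)
    + ((1 + σ * p 2) * (b 1 - dt p b * p 1) - (σ * b 2 - dt p b * (σ * p 2)) * p 1 : ℝ) * I

theorem ch_cont (σ : ℝ) {X : Type} [TopologicalSpace X] (p b : X → TwoSphere) (hp : Continuous p)
    (hb : Continuous b) : Continuous fun x => ch σ (p x).1 (b x).1 := by
  have d1 : ∀ i : Fin 3, Continuous fun x => (p x).1 i := fun i =>
    (continuous_apply i).comp ((PiLp.continuous_ofLp 2 _).comp (continuous_subtype_val.comp hp))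
  have d2 : ∀ i : Fin 3, Continuous fun x => (b x).1 i := fun i =>
    (continuous_apply i).comp ((PiLp.continuous_ofLp 2 _).comp (continuous_subtype_val.comp hb))
  have e1 := d1 0
  have e2 := d1 1
  have e3 := d1 2
  have e4 := d2 0
  have e5 := d2 1
  have e6 := d2 2
  clear d1 d2
  unfold ch dt
  generalize (fun x => (p x).1 0) = p0 at *
  refine Continuous.add (continuous_ofReal.comp ?_)
    (Continuous.mul (continuous_ofReal.comp ?_) continuous_const)
  · fun_prop
  · fun_prop

theorem ch_rel (ζ : ℂ) (p b : EuclideanSpace ℝ (Fin 3)) (hn : normSq ζ = 1) (x0 : p 0 = ζ.re)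
    (x1 : p 1 = ζ.im) (x2 : p 2 = 0) :
    ch 1 p b = - ζ ^ 2 * (starRingEnd ℂ) (ch (-1) p b) := by
  rw [normSq_apply] at hn
  unfold ch
  have ht : (b 0 - dt p b * p 0) * ζ.re + (b 1 - dt p b * p 1) * ζ.im = 0 := by
    rw [dt, x0, x1, x2]
    linear_combination - (b 0 * ζ.re + b 1 * ζ.im) * hn
  generalize b 0 - dt p b * p 0 = u at *
  generalize b 1 - dt p b * p 1 = v at *
  generalize dt p b = d at *
  generalize b 2 = c at *
  rw [x0, x1, x2, sq]
  apply Complex.ext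
  · simp
    linear_combination 2 * ζ.re * ht + (- u + c * ζ.re) * hn
  · simp
    linear_combination 2 * ζ.im * ht + (- v + c * ζ.im) * hn

theorem ch_ne (σ : ℝ) (hσ : σ ^ 2 = 1) (p b : TwoSphere) (hz : 1 + σ * p.1 2 ≠ 0)
    (g1 : b ≠ p) (g2 : b ≠ -p) : ch σ p.1 b.1 ≠ 0 := by
  have hp := (mem_iff _).1 p.2
  have hb := (mem_iff _).1 b.2
  have hσ0 : σ ≠ 0 := by rintro rfl; norm_num at hσ
  refine nonvan (p.1 0) (p.1 1) (σ * p.1 2) (b.1 0) (b.1 1) (σ * b.1 2) (dt p.1 b.1)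
    ?_ ?_ ?_ hz ?_ ?_
  · linear_combination hp + (p.1 2) ^ 2 * hσ
  · linear_combination hb + (b.1 2) ^ 2 * hσ
  · unfold dt; linear_combination - (p.1 2) * (b.1 2) * hσ
  · rintro ⟨q1, q2, q3⟩
    apply g1
    ext i
    fin_cases i
    · exact q1
    · exact q2
    · exact mul_left_cancel₀ hσ0 q3
  · rintro ⟨q1, q2, q3⟩
    apply g2
    ext i
    fin_cases i
    · exact q1
    · exact q2
    · exact mul_left_cancel₀ hσ0 (q3.trans (by simp))

theorem hairy (f : TwoSphere → TwoSphere) (hf : Continuous f)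
    (h1 : ∀ p, f p ≠ p) (h2 : ∀ p, f p ≠ -p) : False := by
  have one : (1 : ℝ) ^ 2 = 1 := by norm_num
  have mone : (-1 : ℝ) ^ 2 = 1 := by norm_num
  have hcont : ∀ (σ : ℝ) (hσ : σ ^ 2 = 1),
      Continuous fun ζ => ch σ (st σ hσ ζ).1 (f (st σ hσ ζ)).1 := fun σ hσ =>
    ch_cont σ _ _ (st_cont σ hσ) (hf.comp (st_cont σ hσ))
  have hne : ∀ (σ : ℝ) (hσ : σ ^ 2 = 1) (ζ : ℂ), ch σ (st σ hσ ζ).1 (f (st σ hσ ζ)).1 ≠ 0 := by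
    intro σ hσ ζ
    have hz : 1 + σ * (st σ hσ ζ).1 2 ≠ 0 := by
      have h : 0 < (1 + normSq ζ) := by have := normSq_nonneg ζ; positivity
      have : 1 + σ * (st σ hσ ζ).1 2 = 2 / (1 + normSq ζ) := by
        simp only [st, PiLp.toLp_apply, Matrix.cons_val]
        field_simp
        rw [hσ]; ring
      rw [this]; positivity
    exact ch_ne σ hσ _ _ hz (h1 _) (h2 _)
  refine no_logs _ _ (hcont 1 one) (hcont (-1) mone) (hne 1 one) (hne (-1) mone) ?_
  intro ζ hζ
  have hn : normSq ζ = 1 := by rw [normSq_eq_norm_sq, hζ]; norm_num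
  have e : st 1 one ζ = st (-1) mone ζ := by
    apply Subtype.ext
    simp [st, hn]
  have x0 : (st (-1) mone ζ).1 0 = ζ.re := by
    simp only [st, PiLp.toLp_apply, Matrix.cons_val, hn]; ring
  have x1 : (st (-1) mone ζ).1 1 = ζ.im := by
    simp only [st, PiLp.toLp_apply, Matrix.cons_val, hn]; ring
  have x2 : (st (-1) mone ζ).1 2 = 0 := by
    simp only [st, PiLp.toLp_apply, Matrix.cons_val, hn]; ring
  rw [e]
  exact ch_rel ζ _ _ hn x0 x1 x2

/-- distance to the other points -/
noncomputable def dl (m : ℕ) (p : ConfPM (m + 2)) : ℝ :=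
  Finset.univ.inf' (Finset.univ_nonempty (α := Fin (m + 1)))
    fun i => min ‖(p.1 0).1 - (p.1 i.succ).1‖ ‖(p.1 0).1 + (p.1 i.succ).1‖

theorem pc {n : ℕ} (i : Fin n) : Continuous fun p : ConfPM n => (p.1 i).1 :=
  continuous_subtype_val.comp ((continuous_apply i).comp continuous_subtype_val)

theorem dl_cont (m : ℕ) : Continuous (dl m) := by
  unfold dl
  refine Continuous.finset_inf'_apply _ fun i _ => ?_
  exact ((pc 0).sub (pc i.succ)).norm.min ((pc 0).add (pc i.succ)).norm

theorem dl_pos (m : ℕ) (p : ConfPM (m + 2)) : 0 < dl m p := by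
  unfold dl
  rw [Finset.lt_inf'_iff]
  intro i _
  have h := p.2 0 i.succ (Fin.succ_ne_zero i).symm
  rw [lt_min_iff, norm_pos_iff, norm_pos_iff]
  refine ⟨fun h' => h.1 (Subtype.ext (sub_eq_zero.1 h')), fun h' => h.2 (Subtype.ext ?_)⟩
  simpa using eq_neg_of_add_eq_zero_left h'

theorem dl_le (m : ℕ) (p : ConfPM (m + 2)) (i : Fin (m + 1)) :
    dl m p ≤ ‖(p.1 0).1 - (p.1 i.succ).1‖ ∧ dl m p ≤ ‖(p.1 0).1 + (p.1 i.succ).1‖ := by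
  rw [← le_min_iff]
  exact Finset.inf'_le (fun i : Fin (m + 1) =>
    min ‖(p.1 0).1 - (p.1 i.succ).1‖ ‖(p.1 0).1 + (p.1 i.succ).1‖) (Finset.mem_univ i)

theorem nrm (x : TwoSphere) : ‖x.1‖ = 1 := by simpa using x.2

/-- unnormalised new point -/
noncomputable def nw (m : ℕ) (p : ConfPM (m + 2)) : EuclideanSpace ℝ (Fin 3) :=
  (p.1 0).1 + (dl m p / 5) • (p.1 1).1

theorem dl_le_two (m : ℕ) (p : ConfPM (m + 2)) : dl m p ≤ 2 := by
  refine (dl_le m p 0).1.trans ((norm_sub_le _ _).trans ?_)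
  rw [nrm, nrm]; norm_num

theorem nw_near (m : ℕ) (p : ConfPM (m + 2)) : ‖nw m p - (p.1 0).1‖ = dl m p / 5 := by
  have := dl_pos m p
  unfold nw
  rw [add_sub_cancel_left, norm_smul, nrm, mul_one, Real.norm_of_nonneg (by positivity)]

theorem nw_norm (m : ℕ) (p : ConfPM (m + 2)) : |‖nw m p‖ - 1| ≤ dl m p / 5 := by
  have h := abs_norm_sub_norm_le (nw m p) (p.1 0).1
  rwa [nw_near, nrm] at h

theorem nw_pos (m : ℕ) (p : ConfPM (m + 2)) : 0 < ‖nw m p‖ := by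
  have h1 := abs_le.1 (nw_norm m p)
  have h2 := dl_le_two m p
  linarith

theorem nw_cont (m : ℕ) : Continuous (nw m) := by
  have := dl_cont m
  exact (pc 0).add ((this.div_const 5).smul (pc 1))

/-- the new point -/
noncomputable def np (m : ℕ) (p : ConfPM (m + 2)) : TwoSphere :=
  ⟨‖nw m p‖⁻¹ • nw m p, by
    have := nw_pos m p
    rw [mem_sphere_zero_iff_norm, norm_smul, norm_inv, norm_norm]
    field_simp⟩

theorem np_cont (m : ℕ) : Continuous (np m) := by
  have := nw_cont m
  unfold np
  refine Continuous.subtype_mk (Continuous.smul (Continuous.inv₀ this.norm fun p => ?_) this) _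
  exact (nw_pos m p).ne'

theorem np_near (m : ℕ) (p : ConfPM (m + 2)) : ‖(p.1 0).1 - (np m p).1‖ < dl m p := by
  have h0 := dl_pos m p
  have h1 : ‖nw m p - (np m p).1‖ ≤ dl m p / 5 := by
    have : nw m p - (np m p).1 = (1 - ‖nw m p‖⁻¹) • nw m p := by
      simp [np, sub_smul]
    rw [this, norm_smul, Real.norm_eq_abs]
    calc _ = |(1 - ‖nw m p‖⁻¹) * ‖nw m p‖| := by rw [abs_mul, abs_norm]
      _ = |‖nw m p‖ - 1| := by
        congr 1
        have := nw_pos m p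
        field_simp
      _ ≤ _ := nw_norm m p
  have h2 := nw_near m p
  have h3 := norm_sub_le_norm_sub_add_norm_sub (p.1 0).1 (nw m p) (np m p).1
  rw [norm_sub_rev (p.1 0).1 (nw m p), h2] at h3
  linarith

theorem np_zero (m : ℕ) (p : ConfPM (m + 2)) (τ : ℝ) (h : (np m p).1 = τ • (p.1 0).1) :
    False := by
  have h0 := dl_pos m p
  have hn := nw_pos m p
  have h1 : nw m p = (‖nw m p‖ * τ) • (p.1 0).1 := by
    rw [mul_smul, ← h]
    simp [np, smul_smul, hn.ne']
  obtain ⟨κ, hκ⟩ : ∃ κ : ℝ, (p.1 1).1 = κ • (p.1 0).1 := by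
    refine ⟨(dl m p / 5)⁻¹ * (‖nw m p‖ * τ - 1), ?_⟩
    have : (dl m p / 5) • (p.1 1).1 = (‖nw m p‖ * τ - 1) • (p.1 0).1 := by
      rw [sub_smul, ← h1, nw]; simp
    rw [mul_smul, ← this, smul_smul, inv_mul_cancel₀ (by positivity), one_smul]
  have hk : |κ| = 1 := by
    have := congrArg norm hκ
    rw [norm_smul, nrm, nrm] at this
    simpa using this.symm
  have h01 := p.2 1 0 (by simp)
  rcases (abs_eq zero_le_one).1 hk with rfl | rfl
  · exact h01.1 (Subtype.ext (by simpa using hκ))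
  · exact h01.2 (Subtype.ext (by simpa using hκ))

theorem np_ne (m : ℕ) (p : ConfPM (m + 2)) (i : Fin (m + 2)) :
    np m p ≠ p.1 i ∧ np m p ≠ - p.1 i := by
  have hnear := np_near m p
  induction i using Fin.cases with
  | zero =>
    refine ⟨fun h => np_zero m p 1 ?_, fun h => np_zero m p (-1) ?_⟩
    · rw [h]; simp
    · rw [h]; simp
  | succ i =>
    have hl := dl_le m p i
    refine ⟨fun h => ?_, fun h => ?_⟩
    · rw [h] at hnear; linarith
    · rw [h] at hnear
      have : (p.1 0).1 - (-p.1 i.succ : TwoSphere).1 = (p.1 0).1 + (p.1 i.succ).1 := by simp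
      rw [this] at hnear; linarith

theorem section_exists (m : ℕ) : ∃ s : ConfPM (m + 2) → ConfPM (m + 2 + 1),
    Continuous s ∧ ∀ p, projPM (m + 2) (s p) = p := by
  refine ⟨fun p => ⟨Fin.snoc (α := fun _ => TwoSphere) p.1 (np m p), ?_⟩, ?_, ?_⟩
  · intro i j
    induction i using Fin.lastCases with
    | last =>
      induction j using Fin.lastCases with
      | last => simp
      | cast j =>
        intro _
        simpa using np_ne m p j
    | cast i =>
      induction j using Fin.lastCases with
      | last =>
        intro _
        have h := np_ne m p i
        simp only [Fin.snoc_castSucc, Fin.snoc_last]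
        refine ⟨h.1.symm, fun h' => h.2 ?_⟩
        rw [h', neg_neg]
      | cast j =>
        intro hij
        simpa using p.2 i j (fun h => hij (by rw [h]))
  · refine Continuous.subtype_mk (continuous_pi fun i => ?_) _
    induction i using Fin.lastCases with
    | last => simpa using np_cont m
    | cast i => simp only [Fin.snoc_castSucc]; exact (continuous_apply i).comp continuous_subtype_val
  · intro p
    apply Subtype.ext
    funext i
    simp [projPM]

theorem no_section (s : ConfPM 1 → ConfPM (1 + 1)) (hs : Continuous s)
    (h : ∀ p, projPM 1 (s p) = p) : False := by
  let c : TwoSphere → ConfPM 1 := fun x => ⟨fun _ => x, fun i j hij =>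
    absurd (Subsingleton.elim i j) hij⟩
  have hc : Continuous c := Continuous.subtype_mk (by fun_prop) _
  have h0 : ∀ x, (s (c x)).1 0 = x := fun x => congrFun (congrArg Subtype.val (h (c x))) 0
  refine hairy (fun x => (s (c x)).1 1) ?_ ?_ ?_
  · have := hs.comp hc
    exact (continuous_apply _).comp (continuous_subtype_val.comp this)
  · intro x hx
    exact ((s (c x)).2 1 0 (by simp)).1 (by rw [h0]; exact hx)
  · intro x hx
    exact ((s (c x)).2 1 0 (by simp)).2 (by rw [h0]; exact hx)

end HB

/-- For `n ≥ 1`, the projection `π^n : C_{n+1}^±(S²) → C_n^±(S²)` admits a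
continuous cross-section if and only if `n ≥ 2`; in particular there is no
continuous section of `C₂^±(S²) → C₁^±(S²) = S²`. -/
theorem stmt_16 :
    ∀ n : ℕ, 1 ≤ n →
      ((∃ s : ConfPM n → ConfPM (n + 1),
          Continuous s ∧ ∀ p, projPM n (s p) = p) ↔ 2 ≤ n) := by
  intro n hn
  constructor
  · rintro ⟨s, hs, h⟩
    by_contra hlt
    obtain rfl : n = 1 := by omega
    exact HB.no_section s hs h
  · intro h2
    obtain ⟨m, rfl⟩ := Nat.exists_eq_add_of_le' h2
    exact HB.section_exists m
end
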